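/- arXiv:2312.13047 — 4 statements merged into one kernel-verified Lean document; each statement's English description precedes it below -/
import Mathlib

section
/- Let (X,d) be a compact metric space, let V ⊆ X be clopen and nonempty, and let n > 0 be an integer. Then there exists a finite family 𝓟 of nonempty pairwise disjoint clopen subsets of X such that ⋃𝓟 = V and 𝓟 refines 𝓑_n (every member of 𝓟 is contained in some member of 𝓑_n). Moreover, if X satisfies condition (⋆), then 𝓟 can be chosen so that 𝓟 ⊆ 𝓑_n. -/
/-- Condition (⋆). -/
def SatisfiesStar (X : Type*) [TopologicalSpace X] : Prop :=
  ∀ x : X, (connectedComponent x).Nontrivial →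
    ∃ h : ↥(Set.Icc (0:ℝ) 1) ≃ₜ ↥(connectedComponent x),
      IsOpen (connectedComponent x \
        {((h ⟨0, by norm_num⟩ : ↥(connectedComponent x)) : X),
         ((h ⟨1, by norm_num⟩ : ↥(connectedComponent x)) : X)})

/-- `B*(Y,ε)`. -/
def Bstar {X : Type*} [MetricSpace X] (Y : Set X) (ε : ℝ) : Set X :=
  interior Y ∪ Metric.thickening ε (Y \ interior Y)

/-- The family `𝓑ₙ`. -/
def BFam (X : Type*) [MetricSpace X] (n : ℕ) : Set (Set X) :=
  {V | IsClopen V ∧ ∃ x : X,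
    connectedComponent x ⊆ V ∧ V ⊆ Bstar (connectedComponent x) (1 / n)}

open Set

/-- `W` is a union of finitely many nonempty pairwise disjoint clopen members of `𝓑`. -/
def HasClopenPartition {X : Type*} [TopologicalSpace X] (𝓑 : Set (Set X)) (W : Set X) : Prop :=
  ∃ 𝓟 : Set (Set X), 𝓟.Finite ∧ (∀ A ∈ 𝓟, A.Nonempty ∧ IsClopen A) ∧
    𝓟.PairwiseDisjoint id ∧ ⋃₀ 𝓟 = W ∧ 𝓟 ⊆ 𝓑

namespace HasClopenPartition

variable {X : Type*} [TopologicalSpace X] {𝓑 : Set (Set X)} {U W : Set X}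

theorem empty : HasClopenPartition 𝓑 (∅ : Set X) :=
  ⟨∅, by simp⟩

theorem of_mem (hW : IsClopen W) (hmem : W.Nonempty → W ∈ 𝓑) : HasClopenPartition 𝓑 W := by
  rcases W.eq_empty_or_nonempty with rfl | hne
  · exact empty
  · exact ⟨{W}, by simp [hW, hne, hmem hne]⟩

theorem union (hU : HasClopenPartition 𝓑 U) (hW : HasClopenPartition 𝓑 W)
    (hUW : Disjoint U W) : HasClopenPartition 𝓑 (U ∪ W) := by
  obtain ⟨𝓟, hfin, hclopen, hdisj, rfl, hsub⟩ := hU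
  obtain ⟨𝓠, hfin', hclopen', hdisj', rfl, hsub'⟩ := hW
  refine ⟨𝓟 ∪ 𝓠, hfin.union hfin', ?_, ?_, sUnion_union _ _, union_subset hsub hsub'⟩
  · rintro A (hA | hA)
    exacts [hclopen A hA, hclopen' A hA]
  · refine (pairwiseDisjoint_union).2 ⟨hdisj, hdisj', fun A hA B hB _ => ?_⟩
    exact hUW.mono (subset_sUnion_of_mem hA) (subset_sUnion_of_mem hB)

/-- A clopen compact set can be partitioned as soon as each of its points has a neighbourhood
all of whose clopen subsets can be partitioned. -/
theorem of_local (hW : IsClopen W) (hc : IsCompact W)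
    (hloc : ∀ x ∈ W, ∃ U, IsClopen U ∧ x ∈ U ∧
      ∀ A, IsClopen A → A ⊆ U → HasClopenPartition 𝓑 A) : HasClopenPartition 𝓑 W := by
  obtain ⟨U, -, hWU, h⟩ : ∃ U, IsClopen U ∧ W ⊆ U ∧
      ∀ A, IsClopen A → A ⊆ U → HasClopenPartition 𝓑 A := by
    refine hc.induction_on (p := fun s => ∃ U, IsClopen U ∧ s ⊆ U ∧
      ∀ A, IsClopen A → A ⊆ U → HasClopenPartition 𝓑 A) ?_ ?_ ?_ ?_
    · refine ⟨∅, isClopen_empty, Subset.rfl, fun A _ hA => ?_⟩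
      rw [subset_empty_iff.1 hA]
      exact empty
    · rintro s t hst ⟨U, hU, htU, h⟩
      exact ⟨U, hU, hst.trans htU, h⟩
    · rintro s t ⟨U, hU, hsU, h⟩ ⟨U', hU', htU, h'⟩
      refine ⟨U ∪ U', hU.union hU', union_subset_union hsU htU, fun A hA hAU => ?_⟩
      rw [← inter_union_sdiff A U]
      refine (h _ (hA.inter hU) inter_subset_right).union (h' _ (hA.diff hU) ?_)
        (disjoint_sdiff_right.mono_left inter_subset_right)
      rintro y ⟨hyA, hyU⟩
      exact (hAU hyA).resolve_left hyU
    · intro x hx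
      obtain ⟨U, hU, hxU, h⟩ := hloc x hx
      exact ⟨U, mem_nhdsWithin_of_mem_nhds (hU.isOpen.mem_nhds hxU), U, hU, Subset.rfl, h⟩
  exact h W hW hWU

end HasClopenPartition

/-- In a compact Hausdorff space, components have a basis of clopen neighbourhoods. -/
theorem exists_isClopen_of_connectedComponent_subset {X : Type*} [TopologicalSpace X]
    [CompactSpace X] [T2Space X] {x : X} {O : Set X} (hO : IsOpen O)
    (h : connectedComponent x ⊆ O) :
    ∃ U, IsClopen U ∧ connectedComponent x ⊆ U ∧ U ⊆ O := by
  rw [connectedComponent_eq_iInter_isClopen] at h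
  have : Nonempty { s : Set X // IsClopen s ∧ x ∈ s } := ⟨⟨univ, isClopen_univ, mem_univ x⟩⟩
  obtain ⟨⟨U, hU, hxU⟩, hUO⟩ := exists_subset_nhds_of_compactSpace
    (V := fun s : { s : Set X // IsClopen s ∧ x ∈ s } => s.1)
    (fun a b => ⟨⟨a.1 ∩ b.1, a.2.1.inter b.2.1, a.2.2, b.2.2⟩,
      inter_subset_left, inter_subset_right⟩)
    (fun s => s.2.1.isClosed) (fun y hy => hO.mem_nhds (h hy))
  exact ⟨U, hU, hU.connectedComponent_subset hxU, hUO⟩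

section Bstar

variable {X : Type*} [MetricSpace X]

theorem isOpen_Bstar (Y : Set X) (ε : ℝ) : IsOpen (Bstar Y ε) :=
  isOpen_interior.union Metric.isOpen_thickening

theorem subset_Bstar (Y : Set X) {ε : ℝ} (hε : 0 < ε) : Y ⊆ Bstar Y ε := fun y hy =>
  (em (y ∈ interior Y)).imp id fun h => Metric.self_subset_thickening hε _ ⟨hy, h⟩

theorem Bstar_mono (Y : Set X) {δ ε : ℝ} (h : δ ≤ ε) : Bstar Y δ ⊆ Bstar Y ε :=
  union_subset_union_right _ (Metric.thickening_mono h _)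

theorem connectedComponent_mem_BFam {x : X} (hx : IsOpen (connectedComponent x)) (n : ℕ) :
    connectedComponent x ∈ BFam X n :=
  ⟨⟨isClosed_connectedComponent, hx⟩, x, Subset.rfl, by
    rw [Bstar, hx.interior_eq]
    exact subset_union_left⟩

/-- Under (⋆), a component has at most two points outside its interior. -/
theorem SatisfiesStar.exists_sdiff_interior_subset_pair (hX : SatisfiesStar X) (x : X) :
    ∃ a b, connectedComponent x \ interior (connectedComponent x) ⊆ {a, b} := by
  by_cases hx : (connectedComponent x).Nontrivial
  · obtain ⟨h, ho⟩ := hX x hx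
    refine ⟨h ⟨0, by norm_num⟩, h ⟨1, by norm_num⟩, fun y hy => ?_⟩
    by_contra hne
    exact hy.2 (interior_maximal sdiff_subset ho ⟨hy.1, hne⟩)
  · refine ⟨x, x, fun y hy => Or.inl ?_⟩
    exact not_nontrivial_iff.1 hx hy.1 mem_connectedComponent

variable [CompactSpace X] {n : ℕ} {W : Set X}

/-- Clopen sets of small diameter can be partitioned by members of `𝓑ₙ`. -/
theorem hasClopenPartition_BFam_of_dist_lt (hW : IsClopen W)
    (hsmall : ∀ x ∈ W, ∀ y ∈ W, dist x y < 1 / n) : HasClopenPartition (BFam X n) W := by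
  by_cases h : ∀ x ∈ W, IsOpen (connectedComponent x)
  · refine .of_local hW hW.isClosed.isCompact fun x hx =>
      ⟨connectedComponent x, ⟨isClosed_connectedComponent, h x hx⟩, mem_connectedComponent,
        fun A hA hAx => .of_mem hA ?_⟩
    rintro ⟨y, hy⟩
    have : A = connectedComponent x := by
      refine hAx.antisymm ?_
      rw [connectedComponent_eq (hAx hy)]
      exact hA.connectedComponent_subset hy
    rw [this]
    exact connectedComponent_mem_BFam (h x hx) n
  · push Not at h
    obtain ⟨x, hx, hxo⟩ := h
    have hxW := hW.connectedComponent_subset hx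
    obtain ⟨z, hz⟩ : (connectedComponent x \ interior (connectedComponent x)).Nonempty := by
      rw [sdiff_nonempty]
      exact fun hs => hxo (subset_interior_iff_isOpen.1 hs)
    exact .of_mem hW fun _ => ⟨hW, x, hxW, fun y hy =>
      Or.inr (Metric.mem_thickening_iff.2 ⟨z, hz, hsmall y hy z (hxW hz.1)⟩)⟩

theorem hasClopenPartition_BFam_of_subset_ball (hW : IsClopen W) {a : X} {ε : ℝ}
    (hε : ε ≤ 1 / n / 2) (h : W ⊆ Metric.ball a ε) : HasClopenPartition (BFam X n) W := by
  refine hasClopenPartition_BFam_of_dist_lt hW fun x hx y hy => ?_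
  have hxa := Metric.mem_ball.1 (h hx)
  have hya := Metric.mem_ball.1 (h hy)
  linarith [dist_triangle_right x y a]

theorem hasClopenPartition_BFam_of_subset_balls (hW : IsClopen W) {a b : X} {ε : ℝ}
    (hε : ε ≤ 1 / n / 2) (hab : a ≠ b → ε ≤ dist a b / 2)
    (h : W ⊆ Metric.ball a ε ∪ Metric.ball b ε) : HasClopenPartition (BFam X n) W := by
  rcases eq_or_ne a b with rfl | hne
  · exact hasClopenPartition_BFam_of_subset_ball hW hε (by rwa [union_self] at h)
  have hd : Disjoint (Metric.ball a ε) (Metric.ball b ε) :=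
    Metric.ball_disjoint_ball (by linarith [hab hne])
  have hWa := isClopen_inter_of_disjoint_cover_clopen hW h Metric.isOpen_ball Metric.isOpen_ball hd
  have hWb := isClopen_inter_of_disjoint_cover_clopen hW (union_comm _ _ ▸ h)
    Metric.isOpen_ball Metric.isOpen_ball hd.symm
  rw [← inter_eq_left.2 h, inter_union_distrib_left]
  exact (hasClopenPartition_BFam_of_subset_ball hWa hε inter_subset_right).union
    (hasClopenPartition_BFam_of_subset_ball hWb hε inter_subset_right)
    (hd.mono inter_subset_right inter_subset_right)

theorem SatisfiesStar.hasClopenPartition_BFam (hX : SatisfiesStar X) (hW : IsClopen W)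
    (hn : 0 < n) : HasClopenPartition (BFam X n) W := by
  refine .of_local hW hW.isClosed.isCompact fun x _ => ?_
  obtain ⟨a, b, hpair⟩ := hX.exists_sdiff_interior_subset_pair x
  have hn' : (0 : ℝ) < 1 / n / 2 := by positivity
  obtain ⟨ε, hε0, hε, hab⟩ : ∃ ε : ℝ, 0 < ε ∧ ε ≤ 1 / n / 2 ∧ (a ≠ b → ε ≤ dist a b / 2) := by
    rcases eq_or_ne a b with rfl | hne
    · exact ⟨_, hn', le_rfl, fun h => (h rfl).elim⟩
    · exact ⟨min (1 / n / 2) (dist a b / 2), lt_min hn' (half_pos (dist_pos.2 hne)),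
        min_le_left _ _, fun _ => min_le_right _ _⟩
  obtain ⟨U, hU, hxU, hUB⟩ := exists_isClopen_of_connectedComponent_subset
    (isOpen_Bstar (connectedComponent x) ε) (subset_Bstar _ hε0)
  refine ⟨U, hU, hxU mem_connectedComponent, fun A hA hAU => ?_⟩
  by_cases hxA : connectedComponent x ⊆ A
  · exact .of_mem hA fun _ =>
      ⟨hA, x, hxA, (hAU.trans hUB).trans (Bstar_mono _ (by linarith))⟩
  refine hasClopenPartition_BFam_of_subset_balls hA hε hab fun y hy => ?_
  have hyx : y ∉ connectedComponent x := fun hyx => hxA <| by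
    rw [connectedComponent_eq hyx]
    exact hA.connectedComponent_subset hy
  rcases hUB (hAU hy) with hy' | hy'
  · exact (hyx (interior_subset hy')).elim
  · obtain ⟨z, hz, hyz⟩ := Metric.mem_thickening_iff.1 hy'
    rcases hpair hz with rfl | rfl
    exacts [Or.inl hyz, Or.inr hyz]

theorem hasClopenPartition_refining_BFam (hW : IsClopen W) (hn : 0 < n) :
    HasClopenPartition {A | ∃ U ∈ BFam X n, A ⊆ U} W := by
  refine .of_local hW hW.isClosed.isCompact fun x _ => ?_
  obtain ⟨U, hU, hxU, hUB⟩ := exists_isClopen_of_connectedComponent_subset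
    (isOpen_Bstar (connectedComponent x) (1 / n)) (subset_Bstar _ (by positivity))
  exact ⟨U, hU, hxU mem_connectedComponent, fun A hA hAU =>
    .of_mem hA fun _ => ⟨U, ⟨hU, x, hxU, hUB⟩, hAU⟩⟩

end Bstar

/-- Every nonempty clopen set in a compact metric space can be partitioned into
finitely many nonempty pairwise disjoint clopen sets refining `𝓑ₙ`; under
condition (⋆) the partition may be chosen inside `𝓑ₙ`. -/
theorem clopen_partition_refining_BFam {X : Type*} [MetricSpace X] [CompactSpace X]
    (V : Set X) (hV : IsClopen V) (hVne : V.Nonempty) (n : ℕ) (hn : 0 < n) :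
    ∃ 𝓟 : Set (Set X), 𝓟.Finite ∧
      (∀ W ∈ 𝓟, W.Nonempty ∧ IsClopen W) ∧
      𝓟.PairwiseDisjoint id ∧
      ⋃₀ 𝓟 = V ∧
      (∀ W ∈ 𝓟, ∃ U ∈ BFam X n, W ⊆ U) ∧
      (SatisfiesStar X → 𝓟 ⊆ BFam X n) := by
  by_cases hX : SatisfiesStar X
  · obtain ⟨𝓟, hfin, hclopen, hdisj, hunion, hsub⟩ := hX.hasClopenPartition_BFam hV hn
    exact ⟨𝓟, hfin, hclopen, hdisj, hunion, fun W hW => ⟨W, hsub hW, Subset.rfl⟩, fun _ => hsub⟩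
  · obtain ⟨𝓟, hfin, hclopen, hdisj, hunion, hsub⟩ := hasClopenPartition_refining_BFam hV hn
    exact ⟨𝓟, hfin, hclopen, hdisj, hunion, fun W hW => hsub hW, fun h => (hX h).elim⟩
end

section
/- Let X ⊆ ℝ be a nonempty compact regularly closed set (i.e. X equals the closure in ℝ of its interior in ℝ) such that no X-interval has a free endpoint. Then there exists a homeomorphism f : ℝ → ℝ such that f[X] = C, where C is the model Cantorval. -/
/-- An `X`-interval: a connected component of `X` with more than one point. -/
def IsIntervalOf (X I : Set ℝ) : Prop :=
  (∃ x ∈ X, I = connectedComponentIn X x) ∧ I.Nontrivial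

/-- A point `e` is a free endpoint of `I ⊆ X` if `e` lies in the interior of `I`
relative to the subspace `X`. -/
def FreeEndpoint (X I : Set ℝ) (e : ℝ) : Prop :=
  ∃ U : Set ℝ, IsOpen U ∧ e ∈ U ∧ U ∩ X ⊆ I

/-- `Gstep n` is the set `G_{n+1}` of the construction:
`G₁ = (1/3, 2/3)` and `G_{n+1} = (1/3)·G_n ∪ ((1/3)·G_n + 2/3)`. -/
def Gstep : ℕ → Set ℝ
  | 0 => Set.Ioo (1/3 : ℝ) (2/3 : ℝ)
  | n + 1 => (fun x : ℝ => x / 3) '' Gstep n ∪ (fun x : ℝ => x / 3 + 2/3) '' Gstep n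

/-- The model Cantorval `C = [0,1] \ ⋃_{k ≥ 1} G_{2k}`. -/
def modelCantorval : Set ℝ :=
  Set.Icc (0:ℝ) 1 \ ⋃ k : ℕ, Gstep (2 * k + 1)

section ColoredCantor

variable {α β κ : Type*} [LinearOrder α] [LinearOrder β]

/-- A finite set of pairs is a colored partial isomorphism if it preserves the order and the
colors, and contains two prescribed pairs `e₀` and `e₁`. -/
structure IsColoredPartialIso (c : α → κ) (d : β → κ) (e₀ e₁ : α × β)
    (f : Finset (α × β)) : Prop where
  cmp_eq : ∀ p ∈ f, ∀ q ∈ f, cmp p.1 q.1 = cmp p.2 q.2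
  color_eq : ∀ p ∈ f, c p.1 = d p.2
  left_mem : e₀ ∈ f
  right_mem : e₁ ∈ f

namespace IsColoredPartialIso

variable {c : α → κ} {d : β → κ} {e₀ e₁ : α × β} {f : Finset (α × β)}

theorem swap (hf : IsColoredPartialIso c d e₀ e₁ f) :
    IsColoredPartialIso d c e₀.swap e₁.swap (f.map (Equiv.prodComm α β).toEmbedding) where
  cmp_eq p hp q hq := by
    simp only [Finset.mem_map_equiv] at hp hq
    exact (hf.cmp_eq _ hp _ hq).symm
  color_eq p hp := by
    simp only [Finset.mem_map_equiv] at hp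
    exact (hf.color_eq _ hp).symm
  left_mem := by simpa [Finset.mem_map_equiv] using hf.left_mem
  right_mem := by simpa [Finset.mem_map_equiv] using hf.right_mem

theorem exists_across (hf : IsColoredPartialIso c d e₀ e₁ f)
    (h₀ : IsBot e₀.1) (h₁ : IsTop e₁.1)
    (hd : ∀ u v : β, u < v → ∀ k, ∃ w, u < w ∧ w < v ∧ d w = k) (a : α) :
    ∃ b, c a = d b ∧ ∀ p ∈ f, cmp p.1 a = cmp p.2 b := by
  by_cases h : ∃ b, (a, b) ∈ f
  · obtain ⟨b, hb⟩ := h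
    exact ⟨b, hf.color_eq _ hb, fun p hp ↦ hf.cmp_eq _ hp _ hb⟩
  have hne : ∀ p ∈ f, p.1 ≠ a := fun p hp he ↦ h ⟨p.2, he ▸ hp⟩
  obtain ⟨p, hp, hpmax⟩ := (f.filter (·.1 < a)).exists_max_image Prod.snd
    ⟨e₀, Finset.mem_filter.2 ⟨hf.left_mem, (h₀ a).lt_of_ne (hne _ hf.left_mem)⟩⟩
  obtain ⟨q, hq, hqmin⟩ := (f.filter (a < ·.1)).exists_min_image Prod.snd
    ⟨e₁, Finset.mem_filter.2 ⟨hf.right_mem, (h₁ a).lt_of_ne' (hne _ hf.right_mem)⟩⟩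
  rw [Finset.mem_filter] at hp hq
  obtain ⟨b, hpb, hbq, hb⟩ := hd p.2 q.2
    ((lt_iff_lt_of_cmp_eq_cmp (hf.cmp_eq _ hp.1 _ hq.1)).1 (hp.2.trans hq.2)) (c a)
  refine ⟨b, hb.symm, fun r hr ↦ ?_⟩
  rcases lt_or_gt_of_ne (hne r hr) with hlt | hgt
  · have := (hpmax r (Finset.mem_filter.2 ⟨hr, hlt⟩)).trans_lt hpb
    rw [(cmp_eq_lt_iff _ _).2 hlt, (cmp_eq_lt_iff _ _).2 this]
  · have := hbq.trans_le (hqmin r (Finset.mem_filter.2 ⟨hr, hgt⟩))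
    rw [(cmp_eq_gt_iff _ _).2 hgt, (cmp_eq_gt_iff _ _).2 this]

theorem exists_extend_left (hf : IsColoredPartialIso c d e₀ e₁ f)
    (h₀ : IsBot e₀.1) (h₁ : IsTop e₁.1)
    (hd : ∀ u v : β, u < v → ∀ k, ∃ w, u < w ∧ w < v ∧ d w = k) (a : α) :
    ∃ g, IsColoredPartialIso c d e₀ e₁ g ∧ f ⊆ g ∧ ∃ b, (a, b) ∈ g := by
  obtain ⟨b, hb, hab⟩ := hf.exists_across h₀ h₁ hd a
  refine ⟨insert (a, b) f, ⟨?_, ?_, ?_, ?_⟩, Finset.subset_insert _ _, b,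
    Finset.mem_insert_self _ _⟩
  · intro p hp q hq
    rw [Finset.mem_insert] at hp hq
    rcases hp with (rfl | pf) <;> rcases hq with (rfl | qf)
    · simp only [cmp_self_eq_eq]
    · rw [cmp_eq_cmp_symm]
      exact hab _ qf
    · exact hab _ pf
    · exact hf.cmp_eq _ pf _ qf
  · intro p hp
    rcases Finset.mem_insert.1 hp with rfl | hp
    exacts [hb, hf.color_eq p hp]
  exacts [Finset.mem_insert_of_mem hf.left_mem, Finset.mem_insert_of_mem hf.right_mem]

theorem exists_extend_right (hf : IsColoredPartialIso c d e₀ e₁ f)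
    (h₀ : IsBot e₀.2) (h₁ : IsTop e₁.2)
    (hc : ∀ u v : α, u < v → ∀ k, ∃ w, u < w ∧ w < v ∧ c w = k) (b : β) :
    ∃ g, IsColoredPartialIso c d e₀ e₁ g ∧ f ⊆ g ∧ ∃ a, (a, b) ∈ g := by
  obtain ⟨g, hg, hfg, a, ha⟩ := hf.swap.exists_extend_left h₀ h₁ hc b
  refine ⟨_, hg.swap, fun p hp ↦ ?_, a, ?_⟩
  · have : p.swap ∈ g := hfg (by simpa [Finset.mem_map_equiv] using hp)
    simpa [Finset.mem_map_equiv] using this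
  · simpa [Finset.mem_map_equiv] using ha

end IsColoredPartialIso

/-- Two countable linear orders with endpoints, colored so that every color occurs between any two
points, are isomorphic by a color preserving map as soon as their endpoints have matching
colors. -/
theorem exists_orderIso_color_eq [Countable α] [Countable β] {c : α → κ} {d : β → κ}
    {a₀ a₁ : α} {b₀ b₁ : β} (ha₀ : IsBot a₀) (ha₁ : IsTop a₁) (hb₀ : IsBot b₀) (hb₁ : IsTop b₁)
    (ha : a₀ < a₁) (hb : b₀ < b₁) (h₀ : c a₀ = d b₀) (h₁ : c a₁ = d b₁)
    (hc : ∀ u v : α, u < v → ∀ k, ∃ w, u < w ∧ w < v ∧ c w = k)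
    (hd : ∀ u v : β, u < v → ∀ k, ∃ w, u < w ∧ w < v ∧ d w = k) :
    ∃ e : α ≃o β, ∀ a, c a = d (e a) := by
  cases nonempty_encodable α
  cases nonempty_encodable β
  let P := {f : Finset (α × β) // IsColoredPartialIso c d (a₀, b₀) (a₁, b₁) f}
  let start : P := ⟨{(a₀, b₀), (a₁, b₁)}, by
    constructor
    · intro p hp q hq
      simp only [Finset.mem_insert, Finset.mem_singleton] at hp hq
      rcases hp with rfl | rfl <;> rcases hq with rfl | rfl <;>
        simp [cmp_self_eq_eq, (cmp_eq_lt_iff _ _).2, (cmp_eq_gt_iff _ _).2, ha, hb]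
    · intro p hp
      simp only [Finset.mem_insert, Finset.mem_singleton] at hp
      rcases hp with rfl | rfl
      exacts [h₀, h₁]
    · simp
    · simp⟩
  let D : α ⊕ β → Order.Cofinal P := Sum.elim
    (fun a ↦ ⟨{f | ∃ b, (a, b) ∈ f.1}, fun f ↦
      let ⟨g, hg, hfg, h⟩ := f.2.exists_extend_left ha₀ ha₁ hd a
      ⟨⟨g, hg⟩, h, hfg⟩⟩)
    (fun b ↦ ⟨{f | ∃ a, (a, b) ∈ f.1}, fun f ↦
      let ⟨g, hg, hfg, h⟩ := f.2.exists_extend_right hb₀ hb₁ hc b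
      ⟨⟨g, hg⟩, h, hfg⟩⟩)
  let I : Order.Ideal P := Order.idealOfCofinals start D
  have hF : ∀ a, ∃ b, ∃ f ∈ I, (a, b) ∈ f.1 := fun a ↦
    let ⟨f, ⟨b, hb⟩, hf⟩ := Order.cofinal_meets_idealOfCofinals start D (Sum.inl a)
    ⟨b, f, hf, hb⟩
  have hG : ∀ b, ∃ a, ∃ f ∈ I, (a, b) ∈ f.1 := fun b ↦
    let ⟨f, ⟨a, ha⟩, hf⟩ := Order.cofinal_meets_idealOfCofinals start D (Sum.inr b)
    ⟨a, f, hf, ha⟩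
  choose F hF using hF
  choose G hG using hG
  refine ⟨OrderIso.ofCmpEqCmp F G fun a b ↦ ?_, fun a ↦ ?_⟩
  · obtain ⟨f, hf, ha⟩ := hF a
    obtain ⟨g, hg, hb⟩ := hG b
    obtain ⟨m, _, fm, gm⟩ := I.directed _ hf _ hg
    exact m.2.cmp_eq (a, _) (fm ha) (_, b) (gm hb)
  · obtain ⟨f, -, ha⟩ := hF a
    exact f.2.color_eq _ ha

end ColoredCantor

/-- A strictly increasing bijection between dense subsets of `ℝ` extends to an order
automorphism of `ℝ`. -/
theorem exists_orderIso_eqOn {D E : Set ℝ} (hD : Dense D) (hE : Dense E) {F : ℝ → ℝ}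
    (hF : StrictMonoOn F D) (hDE : F '' D = E) : ∃ f : ℝ ≃o ℝ, Set.EqOn f F D := by
  set f : ℝ → ℝ := fun x ↦ sSup (F '' (D ∩ Set.Iic x))
  have hbdd : ∀ x, ∀ d ∈ D, x < d → F d ∈ upperBounds (F '' (D ∩ Set.Iic x)) := by
    rintro x d hd hxd _ ⟨y, hy, rfl⟩
    exact (hF hy.1 hd (lt_of_le_of_lt hy.2 hxd)).le
  have hle : ∀ x, ∀ d ∈ D, x < d → f x ≤ F d := by
    intro x d hd hxd
    obtain ⟨y, hy, hyx⟩ := hD.exists_lt x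
    exact csSup_le ⟨F y, y, ⟨hy, hyx.le⟩, rfl⟩ (hbdd x d hd hxd)
  have hge : ∀ x, ∀ d ∈ D, d ≤ x → F d ≤ f x := by
    intro x d hd hdx
    obtain ⟨y, hy, hyx⟩ := hD.exists_gt x
    exact le_csSup ⟨F y, hbdd x y hy hyx⟩ ⟨d, ⟨hd, hdx⟩, rfl⟩
  have heq : Set.EqOn f F D := fun d hd ↦ by
    refine IsGreatest.csSup_eq ⟨⟨d, ⟨hd, Set.self_mem_Iic⟩, rfl⟩, ?_⟩
    rintro _ ⟨y, hy, rfl⟩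
    exact hF.monotoneOn hy.1 hd hy.2
  have hmono : StrictMono f := by
    intro x y hxy
    obtain ⟨d, hd, hxd, hdy⟩ := hD.exists_between hxy
    obtain ⟨d', hd', hdd', hdy'⟩ := hD.exists_between hdy
    exact ((hle x d hd hxd).trans_lt (hF hd hd' hdd')).trans_le (hge y d' hd' hdy'.le)
  have hsub : E ⊆ Set.range f := by
    rintro _ hy
    obtain ⟨d, hd, rfl⟩ := hDE.symm ▸ hy
    exact ⟨d, heq hd⟩
  have hcont : Continuous f := hmono.monotone.continuous_of_denseRange (hE.mono hsub)
  have hsurj : Function.Surjective f := by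
    intro y
    obtain ⟨u, hu, huy⟩ := hE.exists_lt y
    obtain ⟨v, hv, hvy⟩ := hE.exists_gt y
    obtain ⟨x, rfl⟩ := hsub hu
    obtain ⟨x', rfl⟩ := hsub hv
    exact mem_range_of_exists_le_of_exists_ge hcont ⟨x, huy.le⟩ ⟨x', hvy.le⟩
  exact ⟨hmono.orderIsoOfSurjective f hsurj, heq⟩

theorem nonempty_orderIso_inter_rat {S T : Set ℝ} (hS : IsOpen S) (hT : IsOpen T)
    (hS' : S.OrdConnected) (hT' : T.OrdConnected) (hSn : S.Nonempty) (hTn : T.Nonempty) :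
    Nonempty (↥(S ∩ Set.range ((↑) : ℚ → ℝ)) ≃o ↥(T ∩ Set.range ((↑) : ℚ → ℝ))) := by
  have count : ∀ A : Set ℝ, Countable ↥(A ∩ Set.range ((↑) : ℚ → ℝ)) := fun A ↦
    ((Set.countable_range _).mono Set.inter_subset_right).to_subtype
  have nonem : ∀ A : Set ℝ, IsOpen A → A.Nonempty →
      Nonempty ↥(A ∩ Set.range ((↑) : ℚ → ℝ)) := fun A hA hn ↦
    (Rat.denseRange_cast.inter_open_nonempty A hA hn).to_subtype
  have dens : ∀ A : Set ℝ, A.OrdConnected →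
      DenselyOrdered ↥(A ∩ Set.range ((↑) : ℚ → ℝ)) := fun A hA ↦ ⟨by
    rintro ⟨a, ha, ha'⟩ ⟨b, hb, hb'⟩ hab
    obtain ⟨q, hq, hq'⟩ := exists_rat_btwn (show a < b from hab)
    exact ⟨⟨q, hA.out ha hb ⟨hq.le, hq'.le⟩, q, rfl⟩, hq, hq'⟩⟩
  have nomin : ∀ A : Set ℝ, IsOpen A → NoMinOrder ↥(A ∩ Set.range ((↑) : ℚ → ℝ)) :=
    fun A hA ↦ ⟨by
      rintro ⟨a, ha, ha'⟩
      obtain ⟨l, hl, hlA⟩ := exists_Ioc_subset_of_mem_nhds (hA.mem_nhds ha) (exists_lt a)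
      obtain ⟨q, hq, hq'⟩ := exists_rat_btwn hl
      exact ⟨⟨q, hlA ⟨hq, hq'.le⟩, q, rfl⟩, hq'⟩⟩
  have nomax : ∀ A : Set ℝ, IsOpen A → NoMaxOrder ↥(A ∩ Set.range ((↑) : ℚ → ℝ)) :=
    fun A hA ↦ ⟨by
      rintro ⟨a, ha, ha'⟩
      obtain ⟨l, hl, hlA⟩ := exists_Ico_subset_of_mem_nhds (hA.mem_nhds ha) (exists_gt a)
      obtain ⟨q, hq, hq'⟩ := exists_rat_btwn hl
      exact ⟨⟨q, hlA ⟨hq.le, hq'⟩, q, rfl⟩, hq⟩⟩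
  have := count S
  have := count T
  have := nonem S hS hSn
  have := nonem T hT hTn
  have := dens S hS'
  have := dens T hT'
  have := nomin S hS
  have := nomin T hT
  have := nomax S hS
  have := nomax T hT
  exact Order.iso_of_countable_dense _ _

theorem exists_strictMonoOn_inter_rat {S T : Set ℝ} (hS : IsOpen S) (hT : IsOpen T)
    (hS' : S.OrdConnected) (hT' : T.OrdConnected) (hSn : S.Nonempty) (hTn : T.Nonempty) :
    ∃ φ : ℝ → ℝ, StrictMonoOn φ (S ∩ Set.range ((↑) : ℚ → ℝ)) ∧
      φ '' (S ∩ Set.range ((↑) : ℚ → ℝ)) = T ∩ Set.range ((↑) : ℚ → ℝ) := by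
  classical
  obtain ⟨e⟩ := nonempty_orderIso_inter_rat hS hT hS' hT' hSn hTn
  refine ⟨fun x ↦ if h : x ∈ S ∩ Set.range ((↑) : ℚ → ℝ) then e ⟨x, h⟩ else 0, ?_, ?_⟩
  · intro x hx y hy hxy
    simp only [hx, hy, dif_pos]
    exact e.strictMono hxy
  · ext y
    constructor
    · rintro ⟨x, hx, rfl⟩
      simp only [hx, dif_pos]
      exact (e ⟨x, hx⟩).2
    · intro hy
      refine ⟨e.symm ⟨y, hy⟩, (e.symm ⟨y, hy⟩).2, ?_⟩
      simp

/-- A nonempty compact regularly closed subset of `ℝ` whose frontier has no isolated points. -/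
structure IsRegularWithPerfectFrontier (X : Set ℝ) : Prop where
  nonempty : X.Nonempty
  isCompact : IsCompact X
  eq_closure_interior : X = closure (interior X)
  exists_ne : ∀ p ∈ frontier X, ∀ x < p, ∀ y > p, ∃ q ∈ frontier X, q ≠ p ∧ q ∈ Set.Ioo x y

theorem IsOpen.ordConnectedComponent {U : Set ℝ} (hU : IsOpen U) (x : ℝ) :
    IsOpen (U.ordConnectedComponent x) := by
  refine isOpen_iff_mem_nhds.2 fun y hy ↦ ?_
  rw [Set.ordConnectedComponent_eq hy]
  exact Set.ordConnectedComponent_mem_nhds.2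
    (hU.mem_nhds (Set.ordConnectedComponent_subset hy))

theorem lt_of_uIcc_subset {α : Type*} [LinearOrder α] {U : Set α} {x y a b : α}
    (hxa : Set.uIcc x a ⊆ U) (hyb : Set.uIcc y b ⊆ U) (hxy : x < y) (h : ¬ Set.uIcc x y ⊆ U) :
    a < b := by
  by_contra! hba
  refine h fun t ht ↦ ?_
  rw [Set.uIcc_of_le hxy.le] at ht
  rcases le_total t a with hta | hat
  · exact hxa (Set.Icc_subset_uIcc ⟨ht.1, hta⟩)
  · exact hyb (Set.Icc_subset_uIcc' ⟨hba.trans hat, ht.2⟩)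

theorem mem_iff_of_uIcc_subset_compl_frontier {X : Set ℝ} {x y : ℝ}
    (h : Set.uIcc x y ⊆ (frontier X)ᶜ) : x ∈ X ↔ y ∈ X := by
  rw [compl_frontier_eq_union_interior] at h
  rcases IsPreconnected.subset_or_subset isOpen_interior isOpen_interior
    (disjoint_compl_right.mono interior_subset interior_subset) h isPreconnected_uIcc with h | h
  · exact iff_of_true (interior_subset (h Set.left_mem_uIcc))
      (interior_subset (h Set.right_mem_uIcc))
  · exact iff_of_false (interior_subset (h Set.left_mem_uIcc))
      (interior_subset (h Set.right_mem_uIcc))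

theorem Set.countable_ordConnectedSection_of_isOpen {U : Set ℝ} (hU : IsOpen U) :
    Countable U.ordConnectedSection := by
  have hq : ∀ l : U.ordConnectedSection, ∃ q : ℚ, (q : ℝ) ∈ U.ordConnectedComponent l := by
    intro l
    obtain ⟨_, h, q, rfl⟩ := (Rat.denseRange_cast (𝕜 := ℝ)).inter_open_nonempty _
      (hU.ordConnectedComponent l)
      (Set.nonempty_ordConnectedComponent.2 (Set.ordConnectedSection_subset l.2))
    exact ⟨q, h⟩
  choose q hq using hq
  refine Function.Injective.countable (f := q) fun l m hlm ↦ Subtype.ext ?_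
  refine Set.eq_of_mem_ordConnectedSection_of_uIcc_subset l.2 m.2 ?_
  have hm := hq m
  rw [← hlm] at hm
  exact Set.mem_ordConnectedComponent_trans (hq l) (Set.mem_ordConnectedComponent_comm.1 hm)

theorem Set.exists_ordConnectedSection_uIcc_subset {α : Type*} [LinearOrder α] {U : Set α} {x : α}
    (hx : x ∈ U) : ∃ l : U.ordConnectedSection, Set.uIcc x l ⊆ U :=
  ⟨⟨_, ⟨x, hx⟩, rfl⟩, Set.ordConnectedProj_mem_ordConnectedComponent U ⟨x, hx⟩⟩

namespace IsRegularWithPerfectFrontier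

variable {X Y : Set ℝ}

theorem exists_between_mem_eq (hX : IsRegularWithPerfectFrontier X) {x y : ℝ}
    (hx : x ∉ frontier X) (hy : y ∉ frontier X) (hxy : x < y)
    (h : ¬ Set.uIcc x y ⊆ (frontier X)ᶜ) (k : Prop) :
    ∃ z ∉ frontier X, x < z ∧ z < y ∧ ¬ Set.uIcc x z ⊆ (frontier X)ᶜ ∧
      ¬ Set.uIcc z y ⊆ (frontier X)ᶜ ∧ (z ∈ X) = k := by
  rw [Set.uIcc_of_le hxy.le, Set.not_subset] at h
  obtain ⟨r, hr, hrX⟩ := h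
  have hcomp : IsCompact (Set.Icc x y ∩ frontier X) := isCompact_Icc.inter_right isClosed_frontier
  have hne : (Set.Icc x y ∩ frontier X).Nonempty := ⟨r, hr, not_not.1 hrX⟩
  obtain ⟨p, ⟨⟨hxp, hpy⟩, hpX⟩, hpmin⟩ := hcomp.exists_isLeast hne
  obtain ⟨q, ⟨⟨hxq, hqy⟩, hqX⟩, hqmax⟩ := hcomp.exists_isGreatest hne
  replace hxp : x < p := hxp.lt_of_ne fun h ↦ hx (h ▸ hpX)
  replace hpy : p < y := hpy.lt_of_ne fun h ↦ hy (h ▸ hpX)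
  replace hqy : q < y := hqy.lt_of_ne fun h ↦ hy (h ▸ hqX)
  have hgt : ∀ s ∈ frontier X, s ≠ p → s ∈ Set.Ioo x y → p < s := fun s hs hsp hsxy ↦
    (hpmin ⟨Set.Ioo_subset_Icc_self hsxy, hs⟩).lt_of_ne' hsp
  have hpq : p < q := by
    obtain ⟨s, hs, hsp, hsxy⟩ := hX.exists_ne p hpX x hxp y hpy
    exact (hgt s hs hsp hsxy).trans_le (hqmax ⟨Set.Ioo_subset_Icc_self hsxy, hs⟩)
  obtain ⟨s, hs, hsp, hsxq⟩ := hX.exists_ne p hpX x hxp q hpq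
  have hsnhds : Set.Ioo p q ∈ nhds s :=
    Ioo_mem_nhds (hgt s hs hsp ⟨hsxq.1, hsxq.2.trans hqy⟩) hsxq.2
  have hXcl : IsClosed X := hX.isCompact.isClosed
  obtain ⟨z, hzX, hz, hzk⟩ : ∃ z ∉ frontier X, z ∈ Set.Ioo p q ∧ (z ∈ X) = k := by
    rw [hXcl.frontier_eq] at hs ⊢
    by_cases hk : k
    · obtain ⟨z, hz, hzX⟩ := mem_closure_iff_nhds.1 (hX.eq_closure_interior ▸ hs.1) _ hsnhds
      exact ⟨z, fun h ↦ h.2 hzX, hz, by simp [hk, interior_subset hzX]⟩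
    · obtain ⟨z, hz, hzX⟩ : ∃ z ∈ Set.Ioo p q, z ∉ X := by
        by_contra! h
        exact hs.2 (mem_interior_iff_mem_nhds.2 (Filter.mem_of_superset hsnhds h))
      exact ⟨z, fun h ↦ hzX h.1, hz, by simp [hk, hzX]⟩
  exact ⟨z, hzX, hxp.trans hz.1, hz.2.trans hqy,
    fun h ↦ h (Set.Icc_subset_uIcc ⟨hxp.le, hz.1.le⟩) hpX,
    fun h ↦ h (Set.Icc_subset_uIcc ⟨hz.2.le, hqy.le⟩) hqX, hzk⟩

theorem exists_section_between_mem_eq (hX : IsRegularWithPerfectFrontier X)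
    (u v : (frontier X)ᶜ.ordConnectedSection) (huv : u < v) (k : Prop) :
    ∃ w : (frontier X)ᶜ.ordConnectedSection, u < w ∧ w < v ∧ ((w : ℝ) ∈ X) = k := by
  obtain ⟨z, hz, huz, hzv, huz', hzv', hzk⟩ := hX.exists_between_mem_eq
    (Set.ordConnectedSection_subset u.2) (Set.ordConnectedSection_subset v.2) huv
    (fun h ↦ huv.ne (Subtype.ext
      (Set.eq_of_mem_ordConnectedSection_of_uIcc_subset u.2 v.2 h))) k
  obtain ⟨w, hw⟩ := Set.exists_ordConnectedSection_uIcc_subset (U := (frontier X)ᶜ) hz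
  have hu := Set.self_mem_ordConnectedComponent.2 (Set.ordConnectedSection_subset u.2)
  have hv := Set.self_mem_ordConnectedComponent.2 (Set.ordConnectedSection_subset v.2)
  refine ⟨w, Subtype.coe_lt_coe.1 (lt_of_uIcc_subset hu hw huz huz'),
    Subtype.coe_lt_coe.1 (lt_of_uIcc_subset hw hv hzv hzv'), ?_⟩
  rw [← hzk, mem_iff_of_uIcc_subset_compl_frontier hw]

theorem exists_isBot_isTop (hX : IsRegularWithPerfectFrontier X) :
    ∃ a b : (frontier X)ᶜ.ordConnectedSection,
      IsBot a ∧ IsTop b ∧ a < b ∧ (a : ℝ) ∉ X ∧ (b : ℝ) ∉ X := by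
  have hfr : frontier X ⊆ X := hX.isCompact.isClosed.frontier_subset
  obtain ⟨m, hm⟩ := hX.isCompact.bddBelow
  obtain ⟨M, hM⟩ := hX.isCompact.bddAbove
  have hlt : ∀ t ≤ m - 1, t ∉ X := fun t ht h ↦ by linarith [hm h]
  have hgt : ∀ t ≥ M + 1, t ∉ X := fun t ht h ↦ by linarith [hM h]
  obtain ⟨a, ha⟩ := Set.exists_ordConnectedSection_uIcc_subset (U := (frontier X)ᶜ)
    fun h ↦ hlt _ le_rfl (hfr h)
  obtain ⟨b, hb⟩ := Set.exists_ordConnectedSection_uIcc_subset (U := (frontier X)ᶜ)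
    fun h ↦ hgt _ le_rfl (hfr h)
  have self (l : (frontier X)ᶜ.ordConnectedSection) : Set.uIcc (l : ℝ) l ⊆ (frontier X)ᶜ :=
    Set.self_mem_ordConnectedComponent.2 (Set.ordConnectedSection_subset l.2)
  have hab : m - 1 < M + 1 := by
    obtain ⟨x, hx⟩ := hX.nonempty
    linarith [hm hx, hM hx]
  refine ⟨a, b, fun l ↦ ?_, fun l ↦ ?_,
    Subtype.coe_lt_coe.1 (lt_of_uIcc_subset ha hb hab fun h ↦ ?_),
    (mem_iff_of_uIcc_subset_compl_frontier ha).not.1 (hlt _ le_rfl),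
    (mem_iff_of_uIcc_subset_compl_frontier hb).not.1 (hgt _ le_rfl)⟩
  · by_cases hl : Set.uIcc (m - 1) l ⊆ (frontier X)ᶜ
    · refine (Subtype.ext (Set.eq_of_mem_ordConnectedSection_of_uIcc_subset a.2 l.2 ?_)).le
      exact Set.mem_ordConnectedComponent_trans (Set.mem_ordConnectedComponent_comm.1 ha) hl
    · refine (lt_of_uIcc_subset ha (self l) (lt_of_not_ge fun h ↦ hl ?_) hl).le
      rw [Set.uIcc_of_ge h]
      exact fun t ht ht' ↦ hlt t ht.2 (hfr ht')
  · by_cases hl : Set.uIcc (M + 1) l ⊆ (frontier X)ᶜ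
    · refine (Subtype.ext (Set.eq_of_mem_ordConnectedSection_of_uIcc_subset b.2 l.2 ?_)).ge
      exact Set.mem_ordConnectedComponent_trans (Set.mem_ordConnectedComponent_comm.1 hb) hl
    · refine (lt_of_uIcc_subset (self l) hb (lt_of_not_ge fun h ↦ hl ?_)
        (Set.uIcc_comm (M + 1) (l : ℝ) ▸ hl)).le
      rw [Set.uIcc_of_le h]
      exact fun t ht ht' ↦ hgt t ht.1 (hfr ht')
  · obtain ⟨x, hx⟩ := hX.nonempty
    refine hlt _ le_rfl ((mem_iff_of_uIcc_subset_compl_frontier (y := x) ?_).2 hx)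
    refine (Set.uIcc_subset_uIcc_left (Set.Icc_subset_uIcc ⟨?_, ?_⟩)).trans h
    · linarith [hm hx]
    · linarith [hM hx]

theorem subset_closure_inter_rat (hX : IsRegularWithPerfectFrontier X) :
    X ⊆ closure (X ∩ ((frontier X)ᶜ ∩ Set.range ((↑) : ℚ → ℝ))) := by
  conv_lhs => rw [hX.eq_closure_interior]
  refine closure_minimal ?_ isClosed_closure
  refine (Rat.denseRange_cast.open_subset_closure_inter isOpen_interior).trans
    (closure_mono fun x hx ↦ ⟨interior_subset hx.1, fun h ↦ h.2 hx.1, hx.2⟩)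

theorem dense_compl_frontier_inter_rat (hX : IsRegularWithPerfectFrontier X) :
    Dense ((frontier X)ᶜ ∩ Set.range ((↑) : ℚ → ℝ)) :=
  (interior_eq_empty_iff_dense_compl.1
    (interior_frontier hX.isCompact.isClosed)).inter_of_isOpen_left
    Rat.denseRange_cast isClosed_frontier.isOpen_compl

/-- There is a strictly increasing bijection between the rational points outside the frontiers of
`X` and `Y` which sends points of `X` to points of `Y` and points outside `X` to points
outside `Y`. -/
theorem exists_strictMonoOn (hX : IsRegularWithPerfectFrontier X)
    (hY : IsRegularWithPerfectFrontier Y) :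
    ∃ F : ℝ → ℝ, StrictMonoOn F ((frontier X)ᶜ ∩ Set.range ((↑) : ℚ → ℝ)) ∧
      F '' ((frontier X)ᶜ ∩ Set.range ((↑) : ℚ → ℝ)) =
        (frontier Y)ᶜ ∩ Set.range ((↑) : ℚ → ℝ) ∧
      ∀ x ∈ (frontier X)ᶜ ∩ Set.range ((↑) : ℚ → ℝ), x ∈ X ↔ F x ∈ Y := by
  have hUo : IsOpen (frontier X)ᶜ := isClosed_frontier.isOpen_compl
  have hVo : IsOpen (frontier Y)ᶜ := isClosed_frontier.isOpen_compl
  have := Set.countable_ordConnectedSection_of_isOpen hUo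
  have := Set.countable_ordConnectedSection_of_isOpen hVo
  obtain ⟨a₀, a₁, ha₀, ha₁, ha, ha₀X, ha₁X⟩ := hX.exists_isBot_isTop
  obtain ⟨b₀, b₁, hb₀, hb₁, hb, hb₀Y, hb₁Y⟩ := hY.exists_isBot_isTop
  obtain ⟨g, hg⟩ := exists_orderIso_color_eq
    (c := fun a : (frontier X)ᶜ.ordConnectedSection ↦ (a : ℝ) ∈ X)
    (d := fun b : (frontier Y)ᶜ.ordConnectedSection ↦ (b : ℝ) ∈ Y) ha₀ ha₁ hb₀ hb₁ ha hb
    (by simp [ha₀X, hb₀Y]) (by simp [ha₁X, hb₁Y])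
    hX.exists_section_between_mem_eq hY.exists_section_between_mem_eq
  have hl : ∀ x, ∃ l : (frontier X)ᶜ.ordConnectedSection,
      x ∈ (frontier X)ᶜ → Set.uIcc x l ⊆ (frontier X)ᶜ := by
    intro x
    by_cases hx : x ∈ (frontier X)ᶜ
    · obtain ⟨l, hl⟩ := Set.exists_ordConnectedSection_uIcc_subset hx
      exact ⟨l, fun _ ↦ hl⟩
    · exact ⟨a₀, fun h ↦ absurd h hx⟩
  choose l hl using hl
  have hφ : ∀ u : (frontier X)ᶜ.ordConnectedSection, _ := fun u ↦ exists_strictMonoOn_inter_rat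
    (hUo.ordConnectedComponent u) (hVo.ordConnectedComponent (g u)) inferInstance inferInstance
    (Set.nonempty_ordConnectedComponent.2 (Set.ordConnectedSection_subset u.2))
    (Set.nonempty_ordConnectedComponent.2 (Set.ordConnectedSection_subset (g u).2))
  choose φ hφmono hφim using hφ
  have hmem : ∀ x ∈ (frontier X)ᶜ ∩ Set.range ((↑) : ℚ → ℝ),
      x ∈ (frontier X)ᶜ.ordConnectedComponent (l x) ∩ Set.range ((↑) : ℚ → ℝ) := fun x hx ↦
    ⟨Set.mem_ordConnectedComponent_comm.1 (hl x hx.1), hx.2⟩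
  have hFmem : ∀ x ∈ (frontier X)ᶜ ∩ Set.range ((↑) : ℚ → ℝ),
      φ (l x) x ∈ (frontier Y)ᶜ.ordConnectedComponent (g (l x)) ∩ Set.range ((↑) : ℚ → ℝ) :=
    fun x hx ↦ hφim (l x) ▸ Set.mem_image_of_mem _ (hmem x hx)
  refine ⟨fun x ↦ φ (l x) x, fun x hx y hy hxy ↦ ?_, Set.Subset.antisymm ?_ fun y hy ↦ ?_,
    fun x hx ↦ ?_⟩
  · by_cases hlxy : l x = l y
    · have hx' := hmem x hx
      dsimp only
      rw [hlxy] at hx' ⊢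
      exact hφmono _ hx' (hmem y hy) hxy
    · have hxy' : ¬ Set.uIcc x y ⊆ (frontier X)ᶜ := fun h ↦ hlxy <| Subtype.ext <|
        Set.eq_of_mem_ordConnectedSection_of_uIcc_subset (l x).2 (l y).2 <|
          Set.mem_ordConnectedComponent_trans (hmem x hx).1 <|
            Set.mem_ordConnectedComponent_trans h (hl y hy.1)
      have hlt : l x < l y :=
        Subtype.coe_lt_coe.1 (lt_of_uIcc_subset (hl x hx.1) (hl y hy.1) hxy hxy')
      have hglt : g (l x) < g (l y) := g.strictMono hlt
      exact lt_of_uIcc_subset (hFmem x hx).1 (hFmem y hy).1 hglt fun h ↦ hglt.ne <|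
        Subtype.ext <| Set.eq_of_mem_ordConnectedSection_of_uIcc_subset (g _).2 (g _).2 h
  · rintro _ ⟨x, hx, rfl⟩
    exact ⟨Set.ordConnectedComponent_subset (hFmem x hx).1, (hFmem x hx).2⟩
  · obtain ⟨v, hv⟩ := Set.exists_ordConnectedSection_uIcc_subset hy.1
    obtain ⟨u, rfl⟩ := g.surjective v
    obtain ⟨x, hx, rfl⟩ : y ∈ φ u '' _ := by
      rw [hφim u]
      exact ⟨Set.mem_ordConnectedComponent_comm.1 hv, hy.2⟩
    have hxD : x ∈ (frontier X)ᶜ ∩ Set.range ((↑) : ℚ → ℝ) :=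
      ⟨Set.ordConnectedComponent_subset hx.1, hx.2⟩
    have hlx : l x = u := Subtype.ext <|
      Set.eq_of_mem_ordConnectedSection_of_uIcc_subset (l x).2 u.2 <|
        Set.mem_ordConnectedComponent_trans (hmem x hxD).1
          (Set.mem_ordConnectedComponent_comm.1 hx.1)
    exact ⟨x, hxD, by dsimp only; rw [hlx]⟩
  · rw [mem_iff_of_uIcc_subset_compl_frontier (hl x hx.1),
      ← mem_iff_of_uIcc_subset_compl_frontier (hFmem x hx).1]
    exact (hg (l x)).to_iff

/-- Any two nonempty compact regularly closed subsets of `ℝ` with perfect frontiers are carried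
onto each other by an autohomeomorphism of `ℝ`. -/
theorem exists_homeomorph_image_eq (hX : IsRegularWithPerfectFrontier X)
    (hY : IsRegularWithPerfectFrontier Y) : ∃ f : ℝ ≃ₜ ℝ, f '' X = Y := by
  obtain ⟨F, hF, hFim, hFmem⟩ := hX.exists_strictMonoOn hY
  obtain ⟨e, he⟩ := exists_orderIso_eqOn hX.dense_compl_frontier_inter_rat
    hY.dense_compl_frontier_inter_rat hF hFim
  refine ⟨e.toHomeomorph, Set.Subset.antisymm ?_ ?_⟩
  · rw [Set.image_subset_iff]
    refine hX.subset_closure_inter_rat.trans (closure_minimal ?_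
      (hY.isCompact.isClosed.preimage e.toHomeomorph.continuous))
    intro x hx
    change e x ∈ Y
    rw [he hx.2]
    exact (hFmem x hx.2).1 hx.1
  · refine hY.subset_closure_inter_rat.trans (closure_minimal ?_
      (hX.isCompact.image e.toHomeomorph.continuous).isClosed)
    rintro y ⟨hy, hyV⟩
    rw [← hFim] at hyV
    obtain ⟨x, hx, rfl⟩ := hyV
    exact ⟨x, (hFmem x hx).2 hy, he hx⟩

end IsRegularWithPerfectFrontier

/-- A frontier point of a regularly closed set which is isolated in the frontier is a free endpoint
of an interval. -/
theorem exists_mem_frontier_ne_of_not_freeEndpoint {X : Set ℝ} (hcl : IsClosed X)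
    (hreg : X = closure (interior X))
    (hfree : ∀ I : Set ℝ, IsIntervalOf X I →
      ∀ e : ℝ, (IsLeast I e ∨ IsGreatest I e) → ¬ FreeEndpoint X I e)
    {p x y : ℝ} (hp : p ∈ frontier X) (hx : x < p) (hy : p < y) :
    ∃ q ∈ frontier X, q ≠ p ∧ q ∈ Set.Ioo x y := by
  by_contra! h
  rw [hcl.frontier_eq] at hp h
  obtain ⟨hpX, hpi⟩ := hp
  have hside : ∀ a b, Set.Ioo a b ⊆ Set.Ioo x y → p ∉ Set.Ioo a b →
      Set.Ioo a b ⊆ interior X ∨ Set.Ioo a b ⊆ Xᶜ := fun a b hab hpab ↦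
    IsPreconnected.subset_or_subset isOpen_interior hcl.isOpen_compl
      (Set.disjoint_left.2 fun _ hz hz' ↦ hz' (interior_subset hz))
      (fun z hz ↦ by
        by_contra hz'
        rw [Set.mem_union, not_or, Set.mem_compl_iff, not_not] at hz'
        exact h z ⟨hz'.2, hz'.1⟩ (fun h' ↦ hpab (h' ▸ hz)) (hab hz))
      isPreconnected_Ioo
  have hcomp : (connectedComponentIn X p).OrdConnected :=
    isPreconnected_connectedComponentIn.ordConnected
  have hpI : p ∈ connectedComponentIn X p := mem_connectedComponentIn hpX
  have hIX : connectedComponentIn X p ⊆ X := connectedComponentIn_subset X p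
  have hsplit : ∀ z ∈ Set.Ioo x y, z = p ∨ z ∈ Set.Ioo x p ∨ z ∈ Set.Ioo p y := fun z hz ↦ by
    rcases lt_trichotomy z p with h | h | h
    exacts [Or.inr (Or.inl ⟨hz.1, h⟩), Or.inl h, Or.inr (Or.inr ⟨h, hz.2⟩)]
  obtain ⟨u, hu⟩ := Set.nonempty_Ioo.2 hx
  obtain ⟨v, hv⟩ := Set.nonempty_Ioo.2 hy
  rcases hside x p (Set.Ioo_subset_Ioo_right hy.le) Set.right_notMem_Ioo with hl | hl <;>
    rcases hside p y (Set.Ioo_subset_Ioo_left hx.le) Set.left_notMem_Ioo with hr | hr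
  · refine hpi (mem_interior.2 ⟨Set.Ioo x y, fun z hz ↦ ?_, isOpen_Ioo, hx, hy⟩)
    rcases hsplit z hz with rfl | hz | hz
    exacts [hpX, interior_subset (hl hz), interior_subset (hr hz)]
  · have hsub : Set.Ioc x p ⊆ connectedComponentIn X p :=
      isPreconnected_Ioc.subset_connectedComponentIn ⟨hx, le_rfl⟩ fun z hz ↦
        hz.2.eq_or_lt.elim (fun h ↦ h ▸ hpX) fun h ↦ interior_subset (hl ⟨hz.1, h⟩)
    refine hfree _ ⟨⟨p, hpX, rfl⟩, ⟨u, hsub ⟨hu.1, hu.2.le⟩, p, hpI, hu.2.ne⟩⟩ p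
      (Or.inr ⟨hpI, fun z hz ↦ le_of_not_gt fun hpz ↦ ?_⟩)
      ⟨Set.Ioo x y, isOpen_Ioo, ⟨hx, hy⟩, fun z hz ↦ ?_⟩
    · obtain ⟨w, hw⟩ := Set.nonempty_Ioo.2 (lt_min hpz hy)
      exact hr ⟨hw.1, hw.2.trans_le (min_le_right _ _)⟩
        (hIX (hcomp.out hpI hz ⟨hw.1.le, hw.2.le.trans (min_le_left _ _)⟩))
    · rcases hsplit z hz.1 with rfl | hz' | hz'
      exacts [hpI, hsub ⟨hz'.1, hz'.2.le⟩, absurd hz.2 (hr hz')]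
  · have hsub : Set.Ico p y ⊆ connectedComponentIn X p :=
      isPreconnected_Ico.subset_connectedComponentIn ⟨le_rfl, hy⟩ fun z hz ↦
        hz.1.eq_or_lt.elim (fun h ↦ h ▸ hpX) fun h ↦ interior_subset (hr ⟨h, hz.2⟩)
    refine hfree _ ⟨⟨p, hpX, rfl⟩, ⟨p, hpI, v, hsub ⟨hv.1.le, hv.2⟩, hv.1.ne⟩⟩ p
      (Or.inl ⟨hpI, fun z hz ↦ le_of_not_gt fun hzp ↦ ?_⟩)
      ⟨Set.Ioo x y, isOpen_Ioo, ⟨hx, hy⟩, fun z hz ↦ ?_⟩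
    · obtain ⟨w, hw⟩ := Set.nonempty_Ioo.2 (max_lt hzp hx)
      exact hl ⟨(le_max_right _ _).trans_lt hw.1, hw.2⟩
        (hIX (hcomp.out hz hpI ⟨(le_max_left _ _).trans hw.1.le, hw.2.le⟩))
    · rcases hsplit z hz.1 with rfl | hz' | hz'
      exacts [hpI, absurd hz.2 (hl hz'), hsub ⟨hz'.1.le, hz'.2⟩]
  · obtain ⟨z, hz, hzX⟩ := mem_closure_iff_nhds.1 (hreg ▸ hpX) _ (Ioo_mem_nhds hx hy)
    rcases hsplit z hz with rfl | hz | hz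
    exacts [hpi hzX, hl hz (interior_subset hzX), hr hz (interior_subset hzX)]

theorem isOpen_Gstep (n : ℕ) : IsOpen (Gstep n) := by
  induction n with
  | zero => exact isOpen_Ioo
  | succ n ih =>
    have h₁ : (fun x : ℝ ↦ x / 3) '' Gstep n = (fun x ↦ 3 * x) ⁻¹' Gstep n :=
      congrFun (Set.image_eq_preimage_of_inverse (fun x ↦ by ring) (fun x ↦ by ring)) _
    have h₂ : (fun x : ℝ ↦ x / 3 + 2 / 3) '' Gstep n = (fun x ↦ 3 * x - 2) ⁻¹' Gstep n :=
      congrFun (Set.image_eq_preimage_of_inverse (fun x ↦ by ring) (fun x ↦ by ring)) _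
    rw [Gstep, h₁, h₂]
    exact (ih.preimage (by fun_prop)).union (ih.preimage (by fun_prop))

theorem Gstep_subset_Ioo (n : ℕ) : Gstep n ⊆ Set.Ioo 0 1 := by
  induction n with
  | zero => exact Set.Ioo_subset_Ioo (by norm_num) (by norm_num)
  | succ n ih =>
    rintro _ (⟨x, hx, rfl⟩ | ⟨x, hx, rfl⟩) <;> obtain ⟨h₀, h₁⟩ := ih hx <;>
      constructor <;> dsimp only <;> linarith

theorem div_three_mem_Gstep_succ {n : ℕ} {x : ℝ} (hx : 0 ≤ x ∧ x ≤ 1) :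
    x / 3 ∈ Gstep (n + 1) ↔ x ∈ Gstep n := by
  refine ⟨?_, fun h ↦ Or.inl ⟨x, h, rfl⟩⟩
  rintro (⟨y, hy, h⟩ | ⟨y, hy, h⟩)
  · obtain rfl : y = x := by dsimp only at h; linarith
    exact hy
  · have := (Gstep_subset_Ioo n hy).1
    dsimp only at h
    linarith

theorem div_three_add_mem_Gstep_succ {n : ℕ} {x : ℝ} (hx : 0 ≤ x ∧ x ≤ 1) :
    x / 3 + 2 / 3 ∈ Gstep (n + 1) ↔ x ∈ Gstep n := by
  refine ⟨?_, fun h ↦ Or.inr ⟨x, h, rfl⟩⟩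
  rintro (⟨y, hy, h⟩ | ⟨y, hy, h⟩)
  · have := (Gstep_subset_Ioo n hy).2
    dsimp only at h
    linarith
  · obtain rfl : y = x := by dsimp only at h; linarith
    exact hy

theorem disjoint_Gstep {m n : ℕ} (h : m ≠ n) : Disjoint (Gstep m) (Gstep n) := by
  have zero_succ : ∀ n, Disjoint (Gstep 0) (Gstep (n + 1)) := by
    refine fun n ↦ Set.disjoint_left.2 ?_
    rintro x ⟨h₀, h₁⟩ (⟨y, hy, rfl⟩ | ⟨y, hy, rfl⟩) <;>
      obtain ⟨h₂, h₃⟩ := Gstep_subset_Ioo n hy <;> dsimp only at h₀ h₁ <;> linarith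
  induction m generalizing n with
  | zero =>
    cases n with
    | zero => exact absurd rfl h
    | succ n => exact zero_succ n
  | succ m ih =>
    cases n with
    | zero => exact (zero_succ m).symm
    | succ n =>
      have hmn := ih (n := n) (by simpa using h)
      refine Set.disjoint_left.2 ?_
      rintro x (⟨y, hy, rfl⟩ | ⟨y, hy, rfl⟩) hx <;>
        obtain ⟨h₂, h₃⟩ := Gstep_subset_Ioo m hy
      · exact Set.disjoint_left.1 hmn hy ((div_three_mem_Gstep_succ ⟨h₂.le, h₃.le⟩).1 hx)
      · exact Set.disjoint_left.1 hmn hy ((div_three_add_mem_Gstep_succ ⟨h₂.le, h₃.le⟩).1 hx)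

/-- The points of `[0, 1]` left over when all the sets `Gstep n` are removed. -/
def gstepCantor : Set ℝ := Set.Icc 0 1 \ ⋃ n, Gstep n

theorem mem_gstepCantor {x : ℝ} :
    x ∈ gstepCantor ↔ (0 ≤ x ∧ x ≤ 1) ∧ ∀ n, x ∉ Gstep n := by
  simp [gstepCantor]

theorem zero_mem_gstepCantor : 0 ∈ gstepCantor :=
  mem_gstepCantor.2 ⟨by norm_num, fun n h ↦ (Gstep_subset_Ioo n h).1.false⟩

theorem one_mem_gstepCantor : 1 ∈ gstepCantor :=
  mem_gstepCantor.2 ⟨by norm_num, fun n h ↦ (Gstep_subset_Ioo n h).2.false⟩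

theorem div_three_mem_gstepCantor {x : ℝ} (hx : x ∈ gstepCantor) : x / 3 ∈ gstepCantor := by
  obtain ⟨h, hn⟩ := mem_gstepCantor.1 hx
  refine mem_gstepCantor.2 ⟨⟨by linarith, by linarith⟩, fun n ↦ ?_⟩
  cases n with
  | zero => exact fun h' ↦ by linarith [h'.1]
  | succ n => exact fun h' ↦ hn n ((div_three_mem_Gstep_succ h).1 h')

theorem div_three_add_mem_gstepCantor {x : ℝ} (hx : x ∈ gstepCantor) :
    x / 3 + 2 / 3 ∈ gstepCantor := by
  obtain ⟨h, hn⟩ := mem_gstepCantor.1 hx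
  refine mem_gstepCantor.2 ⟨⟨by linarith, by linarith⟩, fun n ↦ ?_⟩
  cases n with
  | zero => exact fun h' ↦ by linarith [h'.2]
  | succ n => exact fun h' ↦ hn n ((div_three_add_mem_Gstep_succ h).1 h')

theorem exists_of_mem_gstepCantor {x : ℝ} (hx : x ∈ gstepCantor) :
    ∃ y ∈ gstepCantor, x = y / 3 ∨ x = y / 3 + 2 / 3 := by
  obtain ⟨h, hn⟩ := mem_gstepCantor.1 hx
  rcases le_or_gt x (1 / 3) with hx₁ | hx₁
  · have hx₃ : x = 3 * x / 3 := by ring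
    refine ⟨3 * x, mem_gstepCantor.2 ⟨⟨by linarith, by linarith⟩, fun n h' ↦ hn (n + 1) ?_⟩,
      Or.inl hx₃⟩
    rw [hx₃]
    exact Or.inl ⟨_, h', rfl⟩
  · have hx₂ : 2 / 3 ≤ x := le_of_not_gt fun h' ↦ hn 0 ⟨hx₁, h'⟩
    have hx₃ : x = (3 * x - 2) / 3 + 2 / 3 := by ring
    refine ⟨3 * x - 2, mem_gstepCantor.2 ⟨⟨by linarith, by linarith⟩, fun n h' ↦ hn (n + 1) ?_⟩,
      Or.inr hx₃⟩
    rw [hx₃]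
    exact Or.inr ⟨_, h', rfl⟩

theorem exists_gstepCantor_ne_abs_sub_le (n : ℕ) :
    ∀ x ∈ gstepCantor, ∃ y ∈ gstepCantor, y ≠ x ∧ |y - x| ≤ (1 / 3) ^ n := by
  induction n with
  | zero =>
    intro x hx
    obtain ⟨h, -⟩ := mem_gstepCantor.1 hx
    rcases eq_or_ne x 0 with rfl | h₀
    · exact ⟨1, one_mem_gstepCantor, by norm_num, by norm_num⟩
    · exact ⟨0, zero_mem_gstepCantor, h₀.symm,
        abs_le.2 ⟨by norm_num; linarith, by norm_num; linarith⟩⟩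
  | succ n ih =>
    intro x hx
    obtain ⟨y, hy, rfl | rfl⟩ := exists_of_mem_gstepCantor hx <;>
      obtain ⟨z, hz, hne, hzy⟩ := ih y hy
    · refine ⟨z / 3, div_three_mem_gstepCantor hz, fun h ↦ hne (by linarith), ?_⟩
      rw [abs_le] at hzy ⊢
      constructor <;> rw [pow_succ] <;> linarith
    · refine ⟨z / 3 + 2 / 3, div_three_add_mem_gstepCantor hz, fun h ↦ hne (by linarith), ?_⟩
      rw [abs_le] at hzy ⊢
      constructor <;> rw [pow_succ] <;> linarith

theorem exists_Gstep_abs_sub_le (n : ℕ) :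
    ∀ x ∈ gstepCantor, ∃ y ∈ Gstep n, |y - x| ≤ (1 / 3) ^ n := by
  induction n with
  | zero =>
    intro x hx
    obtain ⟨h, -⟩ := mem_gstepCantor.1 hx
    exact ⟨1 / 2, ⟨by norm_num, by norm_num⟩,
      abs_le.2 ⟨by norm_num; linarith, by norm_num; linarith⟩⟩
  | succ n ih =>
    intro x hx
    obtain ⟨y, hy, rfl | rfl⟩ := exists_of_mem_gstepCantor hx <;>
      obtain ⟨z, hz, hzy⟩ := ih y hy
    · refine ⟨z / 3, Or.inl ⟨z, hz, rfl⟩, ?_⟩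
      rw [abs_le] at hzy ⊢
      constructor <;> rw [pow_succ] <;> linarith
    · refine ⟨z / 3 + 2 / 3, Or.inr ⟨z, hz, rfl⟩, ?_⟩
      rw [abs_le] at hzy ⊢
      constructor <;> rw [pow_succ] <;> linarith

theorem exists_pow_third_lt {ε : ℝ} (hε : 0 < ε) : ∃ N, ∀ n ≥ N, (1 / 3 : ℝ) ^ n < ε := by
  obtain ⟨N, hN⟩ := exists_pow_lt_of_lt_one hε (show (1 / 3 : ℝ) < 1 by norm_num)
  exact ⟨N, fun n hn ↦
    (pow_le_pow_of_le_one (by norm_num) (by norm_num) hn).trans_lt hN⟩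

theorem isCompact_modelCantorval : IsCompact modelCantorval :=
  isCompact_Icc.diff (isOpen_iUnion fun _ ↦ isOpen_Gstep _)

theorem gstepCantor_subset_modelCantorval : gstepCantor ⊆ modelCantorval := fun _ hx ↦
  ⟨hx.1, fun h ↦
    hx.2 (Set.iUnion_subset (fun k ↦ Set.subset_iUnion Gstep (2 * k + 1)) h)⟩

theorem Gstep_even_subset_modelCantorval (k : ℕ) : Gstep (2 * k) ⊆ modelCantorval := by
  intro x hx
  refine ⟨Set.Ioo_subset_Icc_self (Gstep_subset_Ioo _ hx), fun h ↦ ?_⟩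
  obtain ⟨j, hj⟩ := Set.mem_iUnion.1 h
  exact Set.disjoint_left.1 (disjoint_Gstep (by omega)) hx hj

theorem Gstep_even_subset_interior (k : ℕ) : Gstep (2 * k) ⊆ interior modelCantorval :=
  interior_maximal (Gstep_even_subset_modelCantorval k) (isOpen_Gstep _)

theorem modelCantorval_subset_union :
    modelCantorval ⊆ gstepCantor ∪ interior modelCantorval := by
  intro x hx
  by_cases h : x ∈ gstepCantor
  · exact Or.inl h
  · obtain ⟨n, hn⟩ : ∃ n, x ∈ Gstep n := by
      simpa [gstepCantor, hx.1.1, hx.1.2] using h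
    rcases Nat.even_or_odd' n with ⟨k, rfl | rfl⟩
    · exact Or.inr (Gstep_even_subset_interior k hn)
    · exact absurd (Set.mem_iUnion.2 ⟨k, hn⟩) hx.2

theorem gstepCantor_subset_closure_interior :
    gstepCantor ⊆ closure (interior modelCantorval) := by
  intro x hx
  refine Metric.mem_closure_iff.2 fun ε hε ↦ ?_
  obtain ⟨N, hN⟩ := exists_pow_third_lt hε
  obtain ⟨y, hy, hyx⟩ := exists_Gstep_abs_sub_le (2 * N) x hx
  refine ⟨y, Gstep_even_subset_interior N hy, ?_⟩
  rw [dist_comm, Real.dist_eq]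
  exact hyx.trans_lt (hN _ (by omega))

theorem modelCantorval_eq_closure_interior :
    modelCantorval = closure (interior modelCantorval) := by
  refine Set.Subset.antisymm (fun x hx ↦ ?_)
    (closure_minimal interior_subset isCompact_modelCantorval.isClosed)
  exact (modelCantorval_subset_union hx).elim (fun h ↦ gstepCantor_subset_closure_interior h)
    fun h ↦ subset_closure h

theorem frontier_modelCantorval : frontier modelCantorval = gstepCantor := by
  rw [isCompact_modelCantorval.isClosed.frontier_eq]
  refine Set.Subset.antisymm (fun x hx ↦ (modelCantorval_subset_union hx.1).resolve_right hx.2)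
    fun x hx ↦ ⟨gstepCantor_subset_modelCantorval hx, fun h ↦ ?_⟩
  obtain ⟨ε, hε, hball⟩ := Metric.isOpen_iff.1 isOpen_interior x h
  obtain ⟨N, hN⟩ := exists_pow_third_lt hε
  obtain ⟨y, hy, hyx⟩ := exists_Gstep_abs_sub_le (2 * N + 1) x hx
  have hyC : y ∈ modelCantorval := interior_subset
    (hball (by rw [Metric.mem_ball, Real.dist_eq]; exact hyx.trans_lt (hN _ (by omega))))
  exact hyC.2 (Set.mem_iUnion.2 ⟨N, hy⟩)

theorem exists_mem_frontier_modelCantorval_ne {p x y : ℝ} (hp : p ∈ frontier modelCantorval)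
    (hx : x < p) (hy : p < y) : ∃ q ∈ frontier modelCantorval, q ≠ p ∧ q ∈ Set.Ioo x y := by
  rw [frontier_modelCantorval] at hp ⊢
  obtain ⟨N, hN⟩ := exists_pow_third_lt (lt_min (sub_pos.2 hx) (sub_pos.2 hy))
  obtain ⟨q, hq, hne, hqp⟩ := exists_gstepCantor_ne_abs_sub_le N p hp
  obtain ⟨h₁, h₂⟩ := lt_min_iff.1 (hqp.trans_lt (hN N le_rfl))
  rw [abs_lt] at h₁ h₂
  exact ⟨q, hq, hne, by linarith, by linarith⟩

/-- A nonempty compact regularly closed subset of `ℝ` none of whose intervals has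
a free endpoint is carried onto the model Cantorval by an autohomeomorphism of `ℝ`. -/
theorem regular_closed_to_modelCantorval (X : Set ℝ)
    (hne : X.Nonempty) (hcomp : IsCompact X)
    (hreg : X = closure (interior X))
    (hfree : ∀ I : Set ℝ, IsIntervalOf X I →
      ∀ e : ℝ, (IsLeast I e ∨ IsGreatest I e) → ¬ FreeEndpoint X I e) :
    ∃ f : ℝ ≃ₜ ℝ, f '' X = modelCantorval := by
  have hX : IsRegularWithPerfectFrontier X :=
    ⟨hne, hcomp, hreg, fun _ hp _ hx _ hy ↦
      exists_mem_frontier_ne_of_not_freeEndpoint hcomp.isClosed hreg hfree hp hx hy⟩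
  have hC : IsRegularWithPerfectFrontier modelCantorval :=
    ⟨⟨0, gstepCantor_subset_modelCantorval zero_mem_gstepCantor⟩, isCompact_modelCantorval,
      modelCantorval_eq_closure_interior,
      fun _ hp _ hx _ hy ↦ exists_mem_frontier_modelCantorval_ne hp hx hy⟩
  exact hX.exists_homeomorph_image_eq hC
end

section
/- Let α be a countable ordinal and let A be a set of ordinals smaller than α, equipped with the topology inherited from the order topology on the ordinals. Then there exists an L-Cantorval X such that the set of X-intervals having no free endpoint, with the topology inherited from the component space 𝓒_X, is homeomorphic to A. -/
/-- An `X`-gap: a bounded connected component of `ℝ \ X`. -/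
def IsGapOf (X G : Set ℝ) : Prop :=
  (∃ x ∈ Xᶜ, G = connectedComponentIn Xᶜ x) ∧ Bornology.IsBounded G

/-- An L-Cantorval. -/
def IsLCantorval (X : Set ℝ) : Prop :=
  X.Nonempty ∧ IsCompact X ∧
  ∀ a b : ℝ, a < b → IsGapOf X (Set.Ioo a b) →
    (∃ I : Set ℝ, IsIntervalOf X I ∧ IsLeast I b) ∧
    ∀ ε : ℝ, 0 < ε →
      {I : Set ℝ | IsIntervalOf X I ∧ (I ∩ Set.Ioo (a - ε) a).Nonempty}.Infinite ∧
      {G : Set ℝ | IsGapOf X G ∧ (G ∩ Set.Ioo (a - ε) a).Nonempty}.Infinite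

/-- The subset of the component space `𝓒_X = ConnectedComponents ↥X`
consisting of the `X`-intervals having no free endpoint. -/
def ZSet (X : Set ℝ) : Set (ConnectedComponents ↥X) :=
  {c | (Subtype.val '' {x : ↥X | ConnectedComponents.mk x = c}).Nontrivial ∧
    ∀ e : ℝ,
      (IsLeast (Subtype.val '' {x : ↥X | ConnectedComponents.mk x = c}) e ∨
       IsGreatest (Subtype.val '' {x : ↥X | ConnectedComponents.mk x = c}) e) →
      ¬ FreeEndpoint X (Subtype.val '' {x : ↥X | ConnectedComponents.mk x = c}) e}

open Set Filter Topology

theorem exists_pos_summable_tsum_le (ι : Type*) [Countable ι] {ε : ℝ} (hε : 0 < ε) :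
    ∃ w : ι → ℝ, (∀ i, 0 < w i) ∧ Summable w ∧ ∑' i, w i ≤ ε := by
  have := Encodable.ofCountable ι
  obtain ⟨w, hw, c, hc, hcε⟩ := posSumOfEncodable hε ι
  exact ⟨w, hw, hc.summable, hc.tsum_eq.trans_le hcε⟩

section Indicator

variable {ι : Type*} {w : ι → ℝ}

theorem tsum_indicator_mono (hw : ∀ i, 0 < w i) (hs : Summable w) {s t : Set ι} (hst : s ⊆ t) :
    ∑' i, s.indicator w i ≤ ∑' i, t.indicator w i :=
  Summable.tsum_le_tsum
    (fun i => indicator_le_indicator_of_subset hst (fun i => (hw i).le) i)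
    (hs.indicator s) (hs.indicator t)

theorem tsum_indicator_lt (hw : ∀ i, 0 < w i) (hs : Summable w) {s t : Set ι} (hst : s ⊆ t)
    {i : ι} (hi : i ∈ t) (hi' : i ∉ s) :
    ∑' i, s.indicator w i < ∑' i, t.indicator w i :=
  Summable.tsum_lt_tsum (i := i)
    (fun i => indicator_le_indicator_of_subset hst (fun i => (hw i).le) i)
    (by simpa [hi, hi'] using hw i) (hs.indicator s) (hs.indicator t)

theorem tsum_indicator_nonneg (hw : ∀ i, 0 < w i) (s : Set ι) :
    0 ≤ ∑' i, s.indicator w i :=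
  tsum_nonneg fun i => indicator_nonneg (fun i _ => (hw i).le) i

theorem tsum_indicator_le (hw : ∀ i, 0 < w i) (hs : Summable w) (s : Set ι) :
    ∑' i, s.indicator w i ≤ ∑' i, w i := by
  simpa using tsum_indicator_mono hw hs (subset_univ s)

theorem tendsto_tsum_indicator (hw : ∀ i, 0 < w i) (hs : Summable w) {β : Type*} {F : Filter β}
    {s : β → Set ι} {t : Set ι} (h : ∀ i, ∀ᶠ x in F, (i ∈ s x ↔ i ∈ t)) :
    Tendsto (fun x => ∑' i, (s x).indicator w i) F (𝓝 (∑' i, t.indicator w i)) := by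
  refine tendsto_tsum_of_dominated_convergence hs (fun i => ?_) (Eventually.of_forall fun x i => ?_)
  · refine tendsto_const_nhds.congr' ?_
    filter_upwards [h i] with x hx
    by_cases hi : i ∈ t <;> simp [hi, hx]
  · refine (norm_indicator_le_norm_self w i).trans ?_
    rw [Real.norm_of_nonneg (hw i).le]

end Indicator

/-- A set of ordinals below a countable ordinal embeds topologically into the open unit interval. -/
theorem exists_isEmbedding_of_countable_ordinal (α : Ordinal.{0})
    (hα : α.card ≤ Cardinal.aleph0) (A : Set Ordinal.{0}) (hA : ∀ β ∈ A, β < α) :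
    ∃ e : A → ℝ, IsEmbedding e ∧ range e ⊆ Ioo 0 1 ∧ (range e).Countable := by
  have hcount : Countable (Iio α) := by
    rw [← Cardinal.mk_le_aleph0_iff, Cardinal.mk_Iio_ordinal]
    exact Cardinal.lift_le_aleph0.2 hα
  have hAc : Countable A := Set.Countable.mono (fun β hβ => hA β hβ) hcount
  obtain ⟨w, hw, hs, hsum⟩ := exists_pos_summable_tsum_le (Iio α) (ε := 1 / 2) (by norm_num)
  set f : Ordinal.{0} → ℝ := fun γ => 1 / 4 + ∑' i, {i : Iio α | i.1 < γ}.indicator w i with hf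
  have hmono : Monotone f := fun γ δ h => by
    have := tsum_indicator_mono hw hs (s := {i : Iio α | i.1 < γ}) (t := {i : Iio α | i.1 < δ})
      (fun i hi => lt_of_lt_of_le hi h)
    simpa [hf] using this
  have hlt : ∀ γ < α, ∀ δ, γ < δ → f γ < f δ := fun γ hγ δ h => by
    have := tsum_indicator_lt hw hs (s := {i : Iio α | i.1 < γ}) (t := {i : Iio α | i.1 < δ})
      (fun i hi => lt_trans hi h) (i := ⟨γ, hγ⟩) h (lt_irrefl γ)
    simpa [hf] using this
  have hcont : Continuous f := by
    refine continuous_const.add (continuous_iff_continuousAt.2 fun γ => ?_)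
    refine tendsto_tsum_indicator hw hs fun i => ?_
    by_cases hi : i.1 < γ
    · filter_upwards [lt_mem_nhds hi] with x hx
      simp [hi, hx]
    · filter_upwards [Iio_mem_nhds (Order.lt_succ_of_le (not_lt.1 hi))] with x hx
      have : ¬ i.1 < x := not_lt.2 (Order.lt_succ_iff.1 hx)
      simp [hi, this]
  refine ⟨fun a => f a, ⟨?_, ?_⟩, ?_, countable_range _⟩
  · rw [isInducing_iff_nhds]
    refine fun a => le_antisymm ((hcont.comp continuous_subtype_val).tendsto a).le_comap ?_
    rw [nhds_subtype_eq_comap, ← tendsto_iff_comap]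
    refine tendsto_order.2 ⟨fun b hb => ?_, fun b hb => ?_⟩
    · have := hlt b (hb.trans (hA _ a.2)) _ hb
      filter_upwards [preimage_mem_comap (Ioi_mem_nhds this)] with x hx
      exact hmono.reflect_lt hx
    · have := hlt _ (hA _ a.2) _ hb
      filter_upwards [preimage_mem_comap (Iio_mem_nhds this)] with x hx
      exact hmono.reflect_lt hx
  · intro a b hab
    refine Subtype.ext (le_antisymm ?_ ?_) <;> refine not_lt.1 fun h => ?_
    · exact (hlt _ (hA _ b.2) _ h).ne' hab
    · exact (hlt _ (hA _ a.2) _ h).ne hab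
  · rintro _ ⟨a, rfl⟩
    have h1 := tsum_indicator_nonneg hw {i : Iio α | i.1 < a.1}
    have h2 := tsum_indicator_le hw hs {i : Iio α | i.1 < a.1}
    simp only [hf, mem_Ioo]
    constructor <;> linarith

/-- `H` is a monotone continuous surjection of the line whose fiber over `x` is `[l x, r x]`,
which is nondegenerate exactly over the points of `D`. -/
structure IsBlowUp (l r H : ℝ → ℝ) (D : Set ℝ) : Prop where
  monotone : Monotone H
  continuous : Continuous H
  le : ∀ x, l x ≤ r x
  eq_iff : ∀ x y, H y = x ↔ l x ≤ y ∧ y ≤ r x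
  lt_iff : ∀ x, l x < r x ↔ x ∈ D

theorem exists_isBlowUp {D : Set ℝ} (hD : D.Countable) : ∃ l r H, IsBlowUp l r H D := by
  have := hD.to_subtype
  obtain ⟨w, hw, hs, -⟩ := exists_pos_summable_tsum_le D one_pos
  set l : ℝ → ℝ := fun x => x + ∑' d, {d : D | d.1 < x}.indicator w d with hl
  set r : ℝ → ℝ := fun x => x + ∑' d, {d : D | d.1 ≤ x}.indicator w d with hr
  have hle : ∀ x, l x ≤ r x := fun x => by
    have := tsum_indicator_mono hw hs (s := {d : D | d.1 < x}) (t := {d : D | d.1 ≤ x})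
      (fun d (hd : d.1 < x) => hd.le)
    simpa [hl, hr] using this
  have hrl : ∀ x x', x < x' → r x < l x' := fun x x' h =>
    add_lt_add_of_lt_of_le h (tsum_indicator_mono hw hs fun d hd => lt_of_le_of_lt hd h)
  have hlx : ∀ x, x ≤ l x := fun x => by
    have := tsum_indicator_nonneg hw {d : D | d.1 < x}
    simpa [hl] using this
  have hltend : ∀ x, Tendsto l (𝓝[<] x) (𝓝 (l x)) := fun x => by
    refine Tendsto.add (tendsto_id.mono_left nhdsWithin_le_nhds)
      (tendsto_tsum_indicator hw hs fun d => ?_)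
    by_cases hd : d.1 < x
    · filter_upwards [nhdsWithin_le_nhds (lt_mem_nhds hd)] with z hz
      simp [hd, hz]
    · filter_upwards [self_mem_nhdsWithin] with z hz
      have : ¬ d.1 < z := fun h => hd (h.trans hz)
      simp [hd, this]
  have hrtend : ∀ x, Tendsto r (𝓝[>] x) (𝓝 (r x)) := fun x => by
    refine Tendsto.add (tendsto_id.mono_left nhdsWithin_le_nhds)
      (tendsto_tsum_indicator hw hs fun d => ?_)
    by_cases hd : d.1 ≤ x
    · filter_upwards [self_mem_nhdsWithin] with z hz
      have : d.1 ≤ z := hd.trans (le_of_lt hz)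
      simp [hd, this]
    · filter_upwards [nhdsWithin_le_nhds (gt_mem_nhds (not_le.1 hd))] with z hz
      simpa [hd] using hz
  set H : ℝ → ℝ := fun y => sSup {x | l x ≤ y} with hH
  have hne : ∀ y, {x | l x ≤ y}.Nonempty := fun y => by
    refine ⟨y - ∑' d, w d, ?_⟩
    have := tsum_indicator_le hw hs {d : D | d.1 < y - ∑' d, w d}
    simp only [hl, mem_ofPred_eq]
    linarith
  have hbdd : ∀ y, BddAbove {x | l x ≤ y} := fun y => ⟨y, fun x hx => (hlx x).trans hx⟩
  have heq : ∀ x y, H y = x ↔ l x ≤ y ∧ y ≤ r x := by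
    refine fun x y => ⟨fun h => ⟨?_, ?_⟩, fun ⟨h1, h2⟩ => ?_⟩
    · refine le_of_tendsto (hltend x) ?_
      filter_upwards [self_mem_nhdsWithin] with z hz
      obtain ⟨z', hz', hzz'⟩ := exists_lt_of_lt_csSup (hne y) (h.symm ▸ hz : z < H y)
      exact ((hle z).trans (hrl _ _ hzz').le).trans hz'
    · refine ge_of_tendsto (hrtend x) ?_
      filter_upwards [self_mem_nhdsWithin] with z hz
      by_contra hc
      have : z ≤ H y := le_csSup (hbdd y) ((hle z).trans (not_le.1 hc).le)
      exact absurd hz (not_lt.2 (h ▸ this))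
    · refine IsGreatest.csSup_eq ⟨h1, fun z hz => not_lt.1 fun hxz => ?_⟩
      exact absurd ((hrl _ _ hxz).trans_le hz) (not_lt.2 h2)
  have hmono : Monotone H := fun y y' h =>
    csSup_le_csSup (hbdd y') (hne y) fun x hx => le_trans hx h
  refine ⟨l, r, H, hmono, hmono.continuous_of_surjective fun x => ⟨l x, ?_⟩, hle, heq,
    fun x => ⟨fun h => ?_, fun h => ?_⟩⟩
  · exact (heq _ _).2 ⟨le_rfl, hle x⟩
  · by_contra hx
    refine h.ne ?_
    have : {d : D | d.1 < x} = {d : D | d.1 ≤ x} := by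
      ext d
      have : d.1 ≠ x := fun h => hx (h ▸ d.2)
      exact this.le_iff_lt.symm
    simp only [hl, hr, this]
  · have := tsum_indicator_lt hw hs (s := {d : D | d.1 < x}) (t := {d : D | d.1 ≤ x})
      (fun d (hd : d.1 < x) => hd.le) (i := ⟨x, h⟩) (le_refl x) (lt_irrefl x)
    simpa [hl, hr] using this

namespace IsBlowUp

variable {l r H : ℝ → ℝ} {D : Set ℝ}

theorem map_left (h : IsBlowUp l r H D) (x : ℝ) : H (l x) = x :=
  (h.eq_iff _ _).2 ⟨le_rfl, h.le x⟩

theorem map_right (h : IsBlowUp l r H D) (x : ℝ) : H (r x) = x :=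
  (h.eq_iff _ _).2 ⟨h.le x, le_rfl⟩

theorem map_lt_iff (h : IsBlowUp l r H D) {x y : ℝ} : H y < x ↔ y < l x := by
  refine ⟨fun hy => h.monotone.reflect_lt (by rwa [h.map_left]), fun hy => ?_⟩
  refine lt_of_le_of_ne ((h.monotone hy.le).trans (h.map_left x).le) fun he => ?_
  exact absurd ((h.eq_iff _ _).1 he).1 (not_le.2 hy)

theorem lt_map_iff (h : IsBlowUp l r H D) {x y : ℝ} : x < H y ↔ r x < y := by
  refine ⟨fun hy => h.monotone.reflect_lt (by rwa [h.map_right]), fun hy => ?_⟩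
  refine lt_of_le_of_ne ((h.map_right x).ge.trans (h.monotone hy.le)) fun he => ?_
  exact absurd ((h.eq_iff _ _).1 he.symm).2 (not_le.2 hy)

theorem right_lt_left (h : IsBlowUp l r H D) {x x' : ℝ} (hx : x < x') : r x < l x' := by
  rwa [← h.map_lt_iff, h.map_right]

end IsBlowUp

/-- The set obtained from the fibers over `[0, 1]` by deleting the left open half of each fiber
over a point of `E`. -/
def halfFiberSet (l r H : ℝ → ℝ) (E : Set ℝ) : Set ℝ :=
  {y | H y ∈ Icc 0 1 ∧ ∀ q ∈ E, y ∉ Ioo (l q) ((l q + r q) / 2)}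

/-- The data used to build a Cantorval: a blow-up of the line at two disjoint subsets `E`, `S` of
the open unit interval, the former of which is order-dense in it. -/
structure IsCantorvalData (l r H : ℝ → ℝ) (E S : Set ℝ) : Prop where
  isBlowUp : IsBlowUp l r H (E ∪ S)
  left_subset : E ⊆ Ioo 0 1
  right_subset : S ⊆ Ioo 0 1
  disjoint : Disjoint E S
  exists_between : ∀ a b, 0 ≤ a → b ≤ 1 → a < b → ∃ q ∈ E, a < q ∧ q < b

theorem nontrivial_Icc_iff_lt {a b : ℝ} : (Icc a b).Nontrivial ↔ a < b := by
  rw [← not_iff_not, not_nontrivial_iff, subsingleton_Icc_iff, not_lt]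

theorem connectedComponentIn_eq_of_subset {F T : Set ℝ} {y : ℝ} (hy : y ∈ T)
    (hT : IsPreconnected T) (hTF : T ⊆ F)
    (hmax : ∀ T', IsPreconnected T' → y ∈ T' → T' ⊆ F → T' ⊆ T) :
    connectedComponentIn F y = T :=
  (hmax _ isPreconnected_connectedComponentIn (mem_connectedComponentIn (hTF hy))
    (connectedComponentIn_subset F y)).antisymm (hT.subset_connectedComponentIn hy hTF)

theorem connectedComponentIn_compl_eq_Ioo {X : Set ℝ} {u v y : ℝ} (hu : u ∈ X) (hv : v ∈ X)
    (huv : Ioo u v ⊆ Xᶜ) (hy : y ∈ Ioo u v) : connectedComponentIn Xᶜ y = Ioo u v := by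
  refine connectedComponentIn_eq_of_subset hy isPreconnected_Ioo huv fun T hT hyT hTX z hz => ?_
  refine ⟨not_le.1 fun h => ?_, not_le.1 fun h => ?_⟩
  · exact hTX (hT.Icc_subset hz hyT ⟨h, hy.1.le⟩) hu
  · exact hTX (hT.Icc_subset hyT hz ⟨hy.2.le, h⟩) hv

theorem image_val_mk_eq {X : Set ℝ} (y : X) :
    Subtype.val '' {x : X | ConnectedComponents.mk x = ConnectedComponents.mk y} =
      connectedComponentIn X y := by
  rw [connectedComponentIn_eq_image y.2]
  congr 1
  ext x
  exact ConnectedComponents.coe_eq_coe'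

theorem mk_eq_mk_of_mem_connectedComponentIn {X : Set ℝ} {x y : X}
    (h : (x : ℝ) ∈ connectedComponentIn X y) :
    ConnectedComponents.mk x = ConnectedComponents.mk y := by
  rw [← image_val_mk_eq] at h
  obtain ⟨z, hz, hzx⟩ := h
  rwa [← Subtype.ext hzx]

theorem mem_connectedComponentIn_of_mk_eq_mk {X : Set ℝ} {x y : X}
    (h : ConnectedComponents.mk x = ConnectedComponents.mk y) :
    (x : ℝ) ∈ connectedComponentIn X y := by
  rw [← image_val_mk_eq]
  exact ⟨x, h, rfl⟩

namespace IsCantorvalData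

variable {l r H : ℝ → ℝ} {E S : Set ℝ}

theorem left_lt_right (h : IsCantorvalData l r H E S) {q : ℝ} (hq : q ∈ E) : l q < r q :=
  (h.isBlowUp.lt_iff q).2 (Or.inl hq)

theorem map_mid (h : IsCantorvalData l r H E S) (q : ℝ) : H ((l q + r q) / 2) = q := by
  have := h.isBlowUp.le q
  exact (h.isBlowUp.eq_iff _ _).2 ⟨by linarith, by linarith⟩

theorem map_eq_of_mem_Ioo (h : IsCantorvalData l r H E S) {q y : ℝ}
    (hy : y ∈ Ioo (l q) ((l q + r q) / 2)) : H y = q := by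
  have := h.isBlowUp.le q
  exact (h.isBlowUp.eq_iff _ _).2 ⟨hy.1.le, by linarith [hy.2]⟩

theorem mem_iff (h : IsCantorvalData l r H E S) {y : ℝ} :
    y ∈ halfFiberSet l r H E ↔
      H y ∈ Icc 0 1 ∧ (H y ∈ E → y ∉ Ioo (l (H y)) ((l (H y) + r (H y)) / 2)) := by
  refine and_congr_right fun _ => ⟨fun hy hE => hy _ hE, fun hy q hq hyq => ?_⟩
  obtain rfl := h.map_eq_of_mem_Ioo hyq
  exact hy hq hyq

theorem mem_of_map_eq (h : IsCantorvalData l r H E S) {s y : ℝ} (hs : s ∈ Icc 0 1) (hsE : s ∉ E)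
    (hy : H y = s) : y ∈ halfFiberSet l r H E := by
  subst hy
  exact h.mem_iff.2 ⟨hs, fun hE => absurd hE hsE⟩

theorem left_mem (h : IsCantorvalData l r H E S) {s : ℝ} (hs : s ∈ Icc 0 1) :
    l s ∈ halfFiberSet l r H E := by
  rw [h.mem_iff, h.isBlowUp.map_left]
  exact ⟨hs, fun _ hl => lt_irrefl _ hl.1⟩

theorem mem_of_mid_le (h : IsCantorvalData l r H E S) {q y : ℝ} (hq : q ∈ E)
    (hy : y ∈ Icc ((l q + r q) / 2) (r q)) : y ∈ halfFiberSet l r H E := by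
  have hle := h.isBlowUp.le q
  have hH : H y = q := (h.isBlowUp.eq_iff _ _).2 ⟨by linarith [hy.1], hy.2⟩
  rw [h.mem_iff, hH]
  exact ⟨Ioo_subset_Icc_self (h.left_subset hq), fun _ hl => absurd hy.1 (not_le.2 hl.2)⟩

theorem mid_mem (h : IsCantorvalData l r H E S) {q : ℝ} (hq : q ∈ E) :
    (l q + r q) / 2 ∈ halfFiberSet l r H E :=
  h.mem_of_mid_le hq ⟨le_rfl, by linarith [h.isBlowUp.le q]⟩

theorem isClosed (h : IsCantorvalData l r H E S) : IsClosed (halfFiberSet l r H E) := by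
  have : halfFiberSet l r H E =
      H ⁻¹' Icc 0 1 ∩ ⋂ q ∈ E, (Ioo (l q) ((l q + r q) / 2))ᶜ := by
    ext y
    simp [halfFiberSet]
  rw [this]
  exact (isClosed_Icc.preimage h.isBlowUp.continuous).inter
    (isClosed_biInter fun q _ => isOpen_Ioo.isClosed_compl)

theorem isCompact (h : IsCantorvalData l r H E S) : IsCompact (halfFiberSet l r H E) := by
  refine isCompact_Icc.of_isClosed_subset h.isClosed (s := Icc (l 0) (r 1)) fun y hy => ?_
  exact ⟨not_lt.1 fun hlt => absurd hy.1.1 (not_le.2 (h.isBlowUp.map_lt_iff.2 hlt)),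
    not_lt.1 fun hlt => absurd hy.1.2 (not_le.2 (h.isBlowUp.lt_map_iff.2 hlt))⟩

theorem not_map_lt_of_isPreconnected (h : IsCantorvalData l r H E S) {T : Set ℝ}
    (hT : IsPreconnected T) (hTX : T ⊆ halfFiberSet l r H E) {x y : ℝ} (hx : x ∈ T) (hy : y ∈ T) :
    ¬ H x < H y := by
  intro hlt
  obtain ⟨q, hq, hxq, hqy⟩ := h.exists_between _ _ (hTX hx).1.1 (hTX hy).1.2 hlt
  have h1 := h.isBlowUp.map_lt_iff.1 hxq
  have h2 := h.isBlowUp.lt_map_iff.1 hqy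
  have h3 := h.left_lt_right hq
  have h4 : (3 * l q + r q) / 4 ∈ T := hT.Icc_subset hx hy ⟨by linarith, by linarith⟩
  exact (hTX h4).2 q hq ⟨by linarith, by linarith⟩

theorem map_eq_of_isPreconnected (h : IsCantorvalData l r H E S) {T : Set ℝ}
    (hT : IsPreconnected T) (hTX : T ⊆ halfFiberSet l r H E) {x y : ℝ} (hx : x ∈ T) (hy : y ∈ T) :
    H x = H y :=
  le_antisymm (not_lt.1 (h.not_map_lt_of_isPreconnected hT hTX hy hx))
    (not_lt.1 (h.not_map_lt_of_isPreconnected hT hTX hx hy))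

theorem connectedComponentIn_of_notMem (h : IsCantorvalData l r H E S) {s y : ℝ}
    (hs : s ∈ Icc 0 1) (hsE : s ∉ E) (hy : H y = s) :
    connectedComponentIn (halfFiberSet l r H E) y = Icc (l s) (r s) :=
  connectedComponentIn_eq_of_subset ((h.isBlowUp.eq_iff _ _).1 hy) isPreconnected_Icc
    (fun _ hz => h.mem_of_map_eq hs hsE ((h.isBlowUp.eq_iff _ _).2 hz))
    fun _ hT hyT hTX _ hz =>
      (h.isBlowUp.eq_iff _ _).1 ((h.map_eq_of_isPreconnected hT hTX hz hyT).trans hy)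

theorem connectedComponentIn_of_mid_le (h : IsCantorvalData l r H E S) {q y : ℝ}
    (hq : q ∈ E) (hy : y ∈ Icc ((l q + r q) / 2) (r q)) :
    connectedComponentIn (halfFiberSet l r H E) y = Icc ((l q + r q) / 2) (r q) := by
  have hlt := h.left_lt_right hq
  have hyq : H y = q := (h.isBlowUp.eq_iff _ _).2 ⟨by linarith [hy.1], hy.2⟩
  refine connectedComponentIn_eq_of_subset hy isPreconnected_Icc
    (fun z hz => h.mem_of_mid_le hq hz) fun T hT hyT hTX z hz => ?_
  have hzq := (h.isBlowUp.eq_iff _ _).1 ((h.map_eq_of_isPreconnected hT hTX hz hyT).trans hyq)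
  refine ⟨not_lt.1 fun hzlt => ?_, hzq.2⟩
  obtain ⟨t, ht1, ht2⟩ := _root_.exists_between (max_lt hzlt (by linarith : l q < (l q + r q) / 2))
  have htT : t ∈ T := hT.Icc_subset hz hyT
    ⟨(le_max_left _ _).trans ht1.le, ht2.le.trans hy.1⟩
  exact (hTX htT).2 q hq ⟨(le_max_right _ _).trans_lt ht1, ht2⟩

theorem connectedComponentIn_left (h : IsCantorvalData l r H E S) {q : ℝ} (hq : q ∈ E) :
    connectedComponentIn (halfFiberSet l r H E) (l q) = {l q} := by
  have hlt := h.left_lt_right hq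
  refine connectedComponentIn_eq_of_subset rfl isPreconnected_singleton
    (singleton_subset_iff.2 (h.left_mem (Ioo_subset_Icc_self (h.left_subset hq))))
    fun T hT hyT hTX z hz => ?_
  have hzq := (h.isBlowUp.eq_iff _ _).1
    ((h.map_eq_of_isPreconnected hT hTX hz hyT).trans (h.isBlowUp.map_left q))
  refine hzq.1.antisymm' (not_lt.1 fun hzlt => ?_)
  obtain ⟨t, ht1, ht2⟩ := _root_.exists_between (lt_min hzlt (by linarith : l q < (l q + r q) / 2))
  have htT : t ∈ T := hT.Icc_subset hyT hz ⟨ht1.le, ht2.le.trans (min_le_left _ _)⟩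
  exact (hTX htT).2 q hq ⟨ht1, ht2.trans_le (min_le_right _ _)⟩

theorem isIntervalOf (h : IsCantorvalData l r H E S) {q : ℝ} (hq : q ∈ E) :
    IsIntervalOf (halfFiberSet l r H E) (Icc ((l q + r q) / 2) (r q)) := by
  have hlt := h.left_lt_right hq
  have hlt' : (l q + r q) / 2 < r q := by linarith
  exact ⟨⟨_, h.mid_mem hq, (h.connectedComponentIn_of_mid_le hq ⟨le_rfl, hlt'.le⟩).symm⟩,
    nontrivial_Icc_iff_lt.2 hlt'⟩

theorem connectedComponentIn_compl (h : IsCantorvalData l r H E S) {q y : ℝ} (hq : q ∈ E)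
    (hy : y ∈ Ioo (l q) ((l q + r q) / 2)) :
    connectedComponentIn (halfFiberSet l r H E)ᶜ y = Ioo (l q) ((l q + r q) / 2) :=
  connectedComponentIn_compl_eq_Ioo (h.left_mem (Ioo_subset_Icc_self (h.left_subset hq)))
    (h.mid_mem hq) (fun _ hz hzX => hzX.2 q hq hz) hy

theorem isGapOf (h : IsCantorvalData l r H E S) {q : ℝ} (hq : q ∈ E) :
    IsGapOf (halfFiberSet l r H E) (Ioo (l q) ((l q + r q) / 2)) := by
  have hlt := h.left_lt_right hq
  have hmem : (3 * l q + r q) / 4 ∈ Ioo (l q) ((l q + r q) / 2) :=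
    ⟨by linarith, by linarith⟩
  exact ⟨⟨_, fun hX => hX.2 q hq hmem, (h.connectedComponentIn_compl hq hmem).symm⟩,
    Metric.isBounded_Ioo _ _⟩

theorem exists_eq_of_isGapOf (h : IsCantorvalData l r H E S) {a b : ℝ} (hab : a < b)
    (hG : IsGapOf (halfFiberSet l r H E) (Ioo a b)) :
    ∃ q ∈ E, a = l q ∧ b = (l q + r q) / 2 := by
  obtain ⟨⟨y, hyX, hy⟩, -⟩ := hG
  by_cases hH : H y ∈ Icc 0 1
  · obtain ⟨q, hq, hyq⟩ : ∃ q ∈ E, y ∈ Ioo (l q) ((l q + r q) / 2) := by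
      by_contra! hc
      exact hyX ⟨hH, hc⟩
    rw [h.connectedComponentIn_compl hq hyq] at hy
    refine ⟨q, hq, ?_, ?_⟩
    · rw [← csInf_Ioo hab, hy, csInf_Ioo (hyq.1.trans hyq.2)]
    · rw [← csSup_Ioo hab, hy, csSup_Ioo (hyq.1.trans hyq.2)]
  · rcases lt_or_ge (H y) 0 with h0 | h0
    · have hsub : Iio (l 0) ⊆ Ioo a b := hy ▸ isPreconnected_Iio.subset_connectedComponentIn
        (h.isBlowUp.map_lt_iff.1 h0)
        fun z hz hzX => absurd hzX.1.1 (not_le.2 (h.isBlowUp.map_lt_iff.2 hz))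
      have := hsub (mem_Iio.2 (min_lt_iff.2 (Or.inr (sub_one_lt (l 0)))) : min a (l 0 - 1) ∈ _)
      exact absurd this.1 (not_lt.2 (min_le_left _ _))
    · have h1 : 1 < H y := not_le.1 fun h1 => hH ⟨h0, h1⟩
      have hsub : Ioi (r 1) ⊆ Ioo a b := hy ▸ isPreconnected_Ioi.subset_connectedComponentIn
        (h.isBlowUp.lt_map_iff.1 h1)
        fun z hz hzX => absurd hzX.1.2 (not_le.2 (h.isBlowUp.lt_map_iff.2 hz))
      have := hsub (mem_Ioi.2 (lt_max_iff.2 (Or.inr (lt_add_one (r 1)))) : max b (r 1 + 1) ∈ _)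
      exact absurd this.2 (not_lt.2 (le_max_left _ _))

theorem infinite_inter_Ioo (h : IsCantorvalData l r H E S) {a b : ℝ} (ha : 0 ≤ a) (hb : b ≤ 1)
    (hab : a < b) : (E ∩ Ioo a b).Infinite := by
  intro hfin
  obtain ⟨q, hq, haq, hqb⟩ := h.exists_between a b ha hb hab
  obtain ⟨m, hm, hmax⟩ := hfin.exists_maximal ⟨q, hq, haq, hqb⟩
  obtain ⟨p, hp, hmp, hpb⟩ := h.exists_between m b (ha.trans hm.2.1.le) hb hm.2.2
  exact absurd (hmax ⟨hp, hm.2.1.trans hmp, hpb⟩ hmp.le) (not_le.2 hmp)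

theorem isLCantorval (h : IsCantorvalData l r H E S) : IsLCantorval (halfFiberSet l r H E) := by
  refine ⟨⟨l 0, h.left_mem ⟨le_rfl, zero_le_one⟩⟩, h.isCompact, fun a b hab hG => ?_⟩
  obtain ⟨q, hq, rfl, rfl⟩ := h.exists_eq_of_isGapOf hab hG
  have hlt := h.left_lt_right hq
  refine ⟨⟨_, h.isIntervalOf hq, isLeast_Icc (by linarith)⟩, fun ε hε => ?_⟩
  have hlt' : max 0 (H (l q - ε)) < q :=
    max_lt (h.left_subset hq).1 (h.isBlowUp.map_lt_iff.2 (by linarith))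
  have hinf := h.infinite_inter_Ioo (le_max_left _ _) (h.left_subset hq).2.le hlt'
  have key : ∀ p ∈ E ∩ Ioo (max 0 (H (l q - ε))) q, l q - ε < l p ∧ l p < r p ∧ r p < l q :=
    fun p hp => ⟨h.isBlowUp.monotone.reflect_lt
      (by rw [h.isBlowUp.map_left]; exact (le_max_right _ _).trans_lt hp.2.1),
      h.left_lt_right hp.1, h.isBlowUp.right_lt_left hp.2.2⟩
  constructor
  · refine infinite_of_injOn_mapsTo (f := fun p => Icc ((l p + r p) / 2) (r p)) ?_ ?_ hinf
    · intro p hp p' _ hpp'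
      have hp := key p hp
      have hmem : r p ∈ Icc ((l p' + r p') / 2) (r p') := by
        rw [← show Icc ((l p + r p) / 2) (r p) = Icc ((l p' + r p') / 2) (r p') from hpp']
        exact right_mem_Icc.2 (by linarith)
      have hle := h.isBlowUp.le p'
      rw [← h.isBlowUp.map_right p]
      exact (h.isBlowUp.eq_iff _ _).2 ⟨by linarith [hmem.1], hmem.2⟩
    · intro p hp
      obtain ⟨h1, h2, h3⟩ := key p hp
      exact ⟨h.isIntervalOf hp.1, r p, right_mem_Icc.2 (by linarith), by linarith, h3⟩
  · refine infinite_of_injOn_mapsTo (f := fun p => Ioo (l p) ((l p + r p) / 2)) ?_ ?_ hinf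
    · intro p hp p' _ hpp'
      have hp := key p hp
      have hmem : (3 * l p + r p) / 4 ∈ Ioo (l p) ((l p + r p) / 2) :=
        ⟨by linarith, by linarith⟩
      rw [← h.map_eq_of_mem_Ioo hmem]
      rw [show Ioo (l p) ((l p + r p) / 2) = Ioo (l p') ((l p' + r p') / 2) from hpp'] at hmem
      exact h.map_eq_of_mem_Ioo hmem
    · intro p hp
      obtain ⟨h1, h2, h3⟩ := key p hp
      exact ⟨h.isGapOf hp.1, (3 * l p + r p) / 4, ⟨by linarith, by linarith⟩,
        by linarith, by linarith⟩

theorem notMem_left (h : IsCantorvalData l r H E S) {s : ℝ} (hs : s ∈ S) : s ∉ E :=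
  fun hE => h.disjoint.notMem_of_mem_left hE hs

theorem left_mem_of_mem_right (h : IsCantorvalData l r H E S) {s : ℝ} (hs : s ∈ S) :
    l s ∈ halfFiberSet l r H E :=
  h.left_mem (Ioo_subset_Icc_self (h.right_subset hs))

theorem not_freeEndpoint_left (h : IsCantorvalData l r H E S) {s : ℝ} (hs : s ∈ S) :
    ¬ FreeEndpoint (halfFiberSet l r H E) (Icc (l s) (r s)) (l s) := by
  rintro ⟨U, hU, hsU, hUX⟩
  obtain ⟨c, hc, hcU⟩ := exists_Ioc_subset_of_mem_nhds (hU.mem_nhds hsU) ⟨l s - 1, by linarith⟩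
  obtain ⟨q, hq, hcq, hqs⟩ := h.exists_between _ s (le_max_left 0 (H c)) (h.right_subset hs).2.le
    (max_lt (h.right_subset hs).1 (h.isBlowUp.map_lt_iff.2 hc))
  have h1 := h.isBlowUp.le q
  have h2 := h.isBlowUp.right_lt_left hqs
  have h3 : c < (l q + r q) / 2 := h.isBlowUp.monotone.reflect_lt
    (by rw [h.map_mid]; exact (le_max_right _ _).trans_lt hcq)
  have := hUX ⟨hcU ⟨h3, by linarith⟩, h.mid_mem hq⟩
  linarith [this.1]

theorem not_freeEndpoint_right (h : IsCantorvalData l r H E S) {s : ℝ} (hs : s ∈ S) :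
    ¬ FreeEndpoint (halfFiberSet l r H E) (Icc (l s) (r s)) (r s) := by
  rintro ⟨U, hU, hsU, hUX⟩
  obtain ⟨c, hc, hcU⟩ := exists_Ico_subset_of_mem_nhds (hU.mem_nhds hsU) ⟨r s + 1, by linarith⟩
  obtain ⟨q, hq, hsq, hqc⟩ := h.exists_between s _ (h.right_subset hs).1.le (min_le_left 1 (H c))
    (lt_min (h.right_subset hs).2 (h.isBlowUp.lt_map_iff.2 hc))
  have h1 := h.isBlowUp.le q
  have h2 := h.isBlowUp.right_lt_left hsq
  have h3 : (l q + r q) / 2 < c := h.isBlowUp.monotone.reflect_lt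
    (by rw [h.map_mid]; exact hqc.trans_le (min_le_right _ _))
  have := hUX ⟨hcU ⟨by linarith, h3⟩, h.mid_mem hq⟩
  linarith [this.2]

theorem mk_mem_ZSet_iff (h : IsCantorvalData l r H E S) (y : halfFiberSet l r H E) :
    ConnectedComponents.mk y ∈ ZSet (halfFiberSet l r H E) ↔ H y ∈ S := by
  simp only [ZSet, mem_ofPred_eq, image_val_mk_eq]
  constructor
  · rintro ⟨hnt, hfree⟩
    by_contra hS
    by_cases hE : H y ∈ E
    · have hlt := h.left_lt_right hE
      have hy := (h.isBlowUp.eq_iff _ _).1 (rfl : H y = H y)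
      rcases hy.1.eq_or_lt with heq | hly
      · rw [← heq, h.connectedComponentIn_left hE] at hnt
        exact not_nontrivial_singleton hnt
      · have hmid : (l (H y) + r (H y)) / 2 ≤ y := not_lt.1 fun hc => y.2.2 _ hE ⟨hly, hc⟩
        rw [h.connectedComponentIn_of_mid_le hE ⟨hmid, hy.2⟩] at hfree
        refine hfree _ (Or.inl (isLeast_Icc (by linarith)))
          ⟨Ioo (l (H y)) (r (H y)), isOpen_Ioo, ⟨by linarith, by linarith⟩, fun z hz => ?_⟩
        exact ⟨not_lt.1 fun hc => hz.2.2 _ hE ⟨hz.1.1, hc⟩, hz.1.2.le⟩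
    · rw [h.connectedComponentIn_of_notMem y.2.1 hE rfl, nontrivial_Icc_iff_lt, h.isBlowUp.lt_iff] at hnt
      exact hnt.elim hE hS
  · intro hS
    rw [h.connectedComponentIn_of_notMem y.2.1 (h.notMem_left hS) rfl]
    refine ⟨nontrivial_Icc_iff_lt.2 ((h.isBlowUp.lt_iff _).2 (Or.inr hS)), fun e he => ?_⟩
    rcases he with he | he
    · rw [he.unique (isLeast_Icc (h.isBlowUp.le _))]
      exact h.not_freeEndpoint_left hS
    · rw [he.unique (isGreatest_Icc (h.isBlowUp.le _))]
      exact h.not_freeEndpoint_right hS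

theorem mk_eq_mk_left (h : IsCantorvalData l r H E S) {y : halfFiberSet l r H E}
    (hy : H y ∈ S) :
    ConnectedComponents.mk y = ConnectedComponents.mk ⟨l (H y), h.left_mem_of_mem_right hy⟩ := by
  refine mk_eq_mk_of_mem_connectedComponentIn ?_
  rw [h.connectedComponentIn_of_notMem y.2.1 (h.notMem_left hy) (h.isBlowUp.map_left _)]
  exact (h.isBlowUp.eq_iff _ _).1 rfl

theorem continuous_mk_left (h : IsCantorvalData l r H E S) :
    Continuous fun s : S =>
      ConnectedComponents.mk (⟨l s, h.left_mem_of_mem_right s.2⟩ : halfFiberSet l r H E) := by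
  refine continuous_def.2 fun W hW => ?_
  have := isCompact_iff_compactSpace.1 h.isCompact
  have hK : IsClosed ((fun y : halfFiberSet l r H E => H y) ''
      (ConnectedComponents.mk ⁻¹' W)ᶜ) :=
    ((ConnectedComponents.continuous_coe.isOpen_preimage W hW).isClosed_compl.isCompact.image
      (h.isBlowUp.continuous.comp continuous_subtype_val)).isClosed
  convert hK.isOpen_compl.preimage continuous_subtype_val using 1
  ext s
  constructor
  · rintro hs ⟨y, hy, hys⟩
    have hyS : H y ∈ S := by
      rw [show H y = s from hys]
      exact s.2
    refine hy ?_
    rw [mem_preimage, h.mk_eq_mk_left hyS]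
    obtain rfl : ⟨H y, hyS⟩ = s := Subtype.ext hys
    exact hs
  · intro hs
    by_contra hW'
    exact hs ⟨_, hW', h.isBlowUp.map_left s⟩

theorem nonempty_homeomorph (h : IsCantorvalData l r H E S) :
    Nonempty (ZSet (halfFiberSet l r H E) ≃ₜ S) := by
  obtain ⟨φ, hφ⟩ : ∃ φ : ConnectedComponents (halfFiberSet l r H E) → ℝ,
      ∀ y, φ (ConnectedComponents.mk y) = H y :=
    ⟨Quotient.lift (fun y => H y) fun x y hxy =>
      h.map_eq_of_isPreconnected isPreconnected_connectedComponentIn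
        (connectedComponentIn_subset _ _)
        (mem_connectedComponentIn_of_mk_eq_mk (Quotient.sound hxy))
        (mem_connectedComponentIn y.2), fun _ => rfl⟩
  have hφc : Continuous φ := by
    rw [ConnectedComponents.isQuotientMap_coe.continuous_iff]
    exact (h.isBlowUp.continuous.comp continuous_subtype_val).congr fun y => (hφ y).symm
  have hφS : ∀ c ∈ ZSet (halfFiberSet l r H E), φ c ∈ S := by
    intro c hc
    obtain ⟨y, rfl⟩ := ConnectedComponents.surjective_coe c
    rw [hφ]
    exact (h.mk_mem_ZSet_iff y).1 hc
  refine ⟨⟨⟨fun c => ⟨φ c, hφS c c.2⟩, fun s => ⟨ConnectedComponents.mk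
    ⟨l s, h.left_mem_of_mem_right s.2⟩, (h.mk_mem_ZSet_iff _).2 ?_⟩, ?_, ?_⟩, ?_, ?_⟩⟩
  · simp [h.isBlowUp.map_left]
  · rintro ⟨c, hc⟩
    obtain ⟨y, rfl⟩ := ConnectedComponents.surjective_coe c
    refine Subtype.ext ?_
    simp only [hφ]
    exact (h.mk_eq_mk_left ((h.mk_mem_ZSet_iff y).1 hc)).symm
  · intro s
    exact Subtype.ext ((hφ _).trans (h.isBlowUp.map_left s))
  · exact (hφc.comp continuous_subtype_val).subtype_mk _
  · exact h.continuous_mk_left.subtype_mk _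

end IsCantorvalData

theorem exists_isCantorvalData {S : Set ℝ} (hS : S ⊆ Ioo 0 1) (hSc : S.Countable) :
    ∃ l r H E, IsCantorvalData l r H E S := by
  obtain ⟨t, htS, htc, htd⟩ := (hSc.dense_compl ℝ).exists_countable_dense_subset
  obtain ⟨l, r, H, h⟩ := exists_isBlowUp ((htc.mono (inter_subset_left (t := Ioo 0 1))).union hSc)
  refine ⟨l, r, H, t ∩ Ioo 0 1, h, inter_subset_right, hS,
    disjoint_left.2 fun x hx hxS => htS hx.1 hxS, fun a b ha hb hab => ?_⟩
  obtain ⟨q, hq, haq, hqb⟩ := htd.exists_between hab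
  exact ⟨q, ⟨hq, ha.trans_lt haq, hqb.trans_le hb⟩, haq, hqb⟩

/-- For every countable ordinal `α` and every set `A` of ordinals below `α`
(with the topology inherited from the order topology on the ordinals),
there is an L-Cantorval `X` whose set of intervals without free endpoints,
as a subspace of the component space `𝓒_X`, is homeomorphic to `A`. -/
theorem exists_LCantorval_with_ZSet (α : Ordinal.{0})
    (hα : α.card ≤ Cardinal.aleph0)
    (A : Set Ordinal.{0}) (hA : ∀ β ∈ A, β < α) :
    ∃ X : Set ℝ, IsLCantorval X ∧ Nonempty (↥(ZSet X) ≃ₜ ↥A) := by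
  obtain ⟨e, he, hsub, hcount⟩ := exists_isEmbedding_of_countable_ordinal α hα A hA
  obtain ⟨l, r, H, E, h⟩ := exists_isCantorvalData hsub hcount
  obtain ⟨φ⟩ := h.nonempty_homeomorph
  exact ⟨_, h.isLCantorval, ⟨φ.trans he.toHomeomorph.symm⟩⟩
end

section
/- There exist continuum many pairwise non-homeomorphic L-Cantorvals; that is, there is a family (X_i)_{i ∈ I} of L-Cantorvals indexed by a set I of cardinality 2^ℵ₀ such that for all distinct i, j ∈ I the spaces X_i and X_j (with their subspace topologies from ℝ) are not homeomorphic. -/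
open Set Filter Topology

/-- A continuous monotone surjection of the line whose nontrivial fibers are those over `Q`. -/
structure CollapsesOnto (f : ℝ → ℝ) (Q : Set ℝ) : Prop where
  continuous : Continuous f
  monotone : Monotone f
  surjective : Function.Surjective f
  nontrivial_fiber : ∀ q ∈ Q, ∃ y z, y < z ∧ f y = q ∧ f z = q
  eq_of_notMem : ∀ y z, f y = f z → f y ∉ Q → y = z

theorem exists_collapsesOnto {Q : Set ℝ} (hQ : Q.Countable) : ∃ f, CollapsesOnto f Q := by
  have := hQ.to_subtype
  have := Encodable.ofCountable Q
  obtain ⟨w, w_pos, c, hc, hc1⟩ := posSumOfEncodable one_pos Q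
  set t : Q → ℝ → ℝ := fun q x => if (q : ℝ) < x then w q else 0 with ht
  have t_nonneg (q x) : 0 ≤ t q x := by
    simp only [ht]; split_ifs <;> simp [(w_pos q).le]
  have t_le (q x) : t q x ≤ w q := by
    simp only [ht]; split_ifs <;> simp [(w_pos q).le]
  have t_mono (q) : Monotone (t q) := by
    intro x y hxy
    simp only [ht]
    split_ifs <;> first | exact le_rfl | exact (w_pos q).le | linarith
  have t_summable (x) : Summable fun q => t q x :=
    .of_nonneg_of_le (fun q => t_nonneg q x) (fun q => t_le q x) hc.summable
  set g : ℝ → ℝ := fun x => x + ∑' q, t q x with hg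
  have g_expand {x y : ℝ} (hxy : x ≤ y) : y - x ≤ g y - g x := by
    have := (t_summable x).tsum_le_tsum (fun q => t_mono q hxy) (t_summable y)
    simp only [hg]; linarith
  have le_g (x : ℝ) : x ≤ g x := by
    have : 0 ≤ ∑' q, t q x := tsum_nonneg fun q => t_nonneg q x
    simp only [hg]; linarith
  have g_le (x : ℝ) : g x ≤ x + 1 := by
    have := (t_summable x).tsum_le_tsum (fun q => t_le q x) hc.summable
    rw [hc.tsum_eq] at this
    simp only [hg]; linarith
  have g_jump (q : Q) {x : ℝ} (hx : (q : ℝ) < x) : g q + w q ≤ g x := by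
    have h := (t_summable x).sub (t_summable q) |>.le_tsum q
      (fun r _ => sub_nonneg.2 (t_mono r hx.le))
    rw [(t_summable x).tsum_sub (t_summable q)] at h
    simp only [ht, if_pos hx, lt_self_iff_false, if_false] at h
    simp only [hg, ht]; linarith
  have g_cont {p : ℝ} (hp : p ∉ Q) : ContinuousAt g p := by
    refine continuousAt_id.add ?_
    refine tendsto_tsum_of_dominated_convergence hc.summable (fun q => ?_)
      (.of_forall fun x q => ?_)
    · have hqp : (q : ℝ) ≠ p := fun h => hp (h ▸ q.2)
      refine tendsto_const_nhds.congr' ?_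
      rcases hqp.lt_or_gt with h | h
      · filter_upwards [lt_mem_nhds h] with x hx
        simp [ht, h, hx]
      · filter_upwards [gt_mem_nhds h] with x hx
        simp [ht, h.not_gt, hx.not_gt]
    · rw [Real.norm_of_nonneg (t_nonneg q x)]; exact t_le q x
  have cut (y : ℝ) : ∃ s, (∀ x < s, g x ≤ y) ∧ ∀ x > s, y < g x := by
    have hne : {x | g x ≤ y}.Nonempty := ⟨y - 1, by simpa using g_le (y - 1)⟩
    have hbd : BddAbove {x | g x ≤ y} := ⟨y, fun x hx => (le_g x).trans hx⟩
    refine ⟨sSup {x | g x ≤ y}, fun x hx => ?_, fun x hx => ?_⟩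
    · obtain ⟨z, hz, hxz⟩ := exists_lt_of_lt_csSup hne hx
      have := g_expand hxz.le
      have hz' : g z ≤ y := hz
      linarith
    · by_contra! h
      exact absurd (le_csSup hbd h) (not_le.2 hx)
  choose f f_lt f_gt using cut
  have f_eq {x y : ℝ} (hlo : g x ≤ y) (hhi : ∀ z > x, y < g z) : f y = x := by
    refine le_antisymm (le_of_not_gt fun h => ?_) (le_of_not_gt fun h => ?_)
    · obtain ⟨z, hxz, hz⟩ := exists_between h
      linarith [f_lt y z hz, hhi z hxz]
    · linarith [f_gt y x h]
  have f_mono : Monotone f := by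
    intro y z hyz
    by_contra! h
    obtain ⟨x, h1, h2⟩ := exists_between h
    linarith [f_lt y x h2, f_gt z x h1]
  have f_lip {y z : ℝ} (hyz : y ≤ z) : f z - f y ≤ z - y := by
    by_contra! h
    have h1 := f_gt y (f y + (f z - f y - (z - y)) / 3) (by linarith)
    have h2 := f_lt z (f z - (f z - f y - (z - y)) / 3) (by linarith)
    have := g_expand (x := f y + (f z - f y - (z - y)) / 3)
      (y := f z - (f z - f y - (z - y)) / 3) (by linarith)
    linarith
  have f_g (x : ℝ) : f (g x) = x :=
    f_eq le_rfl fun z hz => by linarith [g_expand hz.le, hz.lt]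
  refine ⟨f, ?_, f_mono, fun x => ⟨g x, f_g x⟩, fun q hq => ?_, ?_⟩
  · refine (LipschitzWith.of_le_add fun y z => ?_).continuous
    rw [Real.dist_eq]
    rcases le_total y z with h | h
    · linarith [f_mono h, abs_nonneg (y - z)]
    · linarith [f_lip h, le_abs_self (y - z)]
  · refine ⟨g q, g q + w ⟨q, hq⟩ / 2, by linarith [w_pos ⟨q, hq⟩], f_g q, f_eq ?_ fun z hz => ?_⟩
    · linarith [w_pos ⟨q, hq⟩]
    · linarith [w_pos ⟨q, hq⟩, g_jump ⟨q, hq⟩ hz]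
  · suffices H : ∀ y z, y < z → f y = f z → f y ∈ Q by
      intro y z hyz hy
      by_contra hne
      rcases lt_or_gt_of_ne hne with h | h
      · exact hy (H y z h hyz)
      · exact hy (hyz ▸ H z y h hyz.symm)
    intro y z hlt hyz
    by_contra hp
    have hcont := (g_cont hp).tendsto
    have h1 : g (f y) ≤ y :=
      le_of_tendsto (hcont.mono_left nhdsWithin_le_nhds : Tendsto g (𝓝[<] (f y)) _)
        (eventually_mem_nhdsWithin.mono fun x hx => f_lt y x hx)
    have h2 : z ≤ g (f y) :=
      ge_of_tendsto (hcont.mono_left nhdsWithin_le_nhds : Tendsto g (𝓝[>] (f y)) _)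
        (eventually_mem_nhdsWithin.mono fun x hx => (f_gt z x (hyz ▸ hx)).le)
    linarith

/-- `x` is a limit from the left of points of `C`. -/
def IsLeftLimit (C : Set ℝ) (x : ℝ) : Prop := ∀ y < x, (C ∩ Ioo y x).Nonempty

/-- `x` is a limit from the right of points of `C`. -/
def IsRightLimit (C : Set ℝ) (x : ℝ) : Prop := ∀ y > x, (C ∩ Ioo x y).Nonempty

theorem countable_setOf_not_isLeftLimit (C : Set ℝ) : {x ∈ C | ¬ IsLeftLimit C x}.Countable := by
  refine (countable_setOfPred_isolated_left_within (s := C)).mono ?_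
  intro x hx
  refine ⟨hx.1, ?_⟩
  obtain ⟨y, hy, h⟩ : ∃ y < x, ¬ (C ∩ Ioo y x).Nonempty := by
    simpa [IsLeftLimit] using hx.2
  rw [← empty_mem_iff_bot, mem_nhdsWithin]
  exact ⟨Ioi y, isOpen_Ioi, hy, fun z hz => h ⟨z, hz.2.1, hz.1, hz.2.2⟩⟩

/-- To the left of a left limit of a totally disconnected compact set there are gaps. -/
theorem IsLeftLimit.exists_gap {C : Set ℝ} (hC : IsCompact C) (hd : IsTotallyDisconnected C)
    {u y : ℝ} (hu : IsLeftLimit C u) (hy : y < u) :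
    ∃ s ∈ C, ∃ t ∈ C, y < s ∧ s < t ∧ t < u ∧ Ioo s t ⊆ Cᶜ := by
  obtain ⟨c, hc, hyc, hcu⟩ := hu y hy
  obtain ⟨d, hd', hcd, hdu⟩ := hu c hcu
  obtain ⟨z, hz, hzC⟩ : ∃ z ∈ Icc c d, z ∉ C := by
    by_contra! h
    exact hcd.ne (hd _ h isPreconnected_Icc (left_mem_Icc.2 hcd.le) (right_mem_Icc.2 hcd.le))
  obtain ⟨s, hs⟩ := (hC.inter_right (isClosed_Iic (a := z))).exists_isGreatest ⟨c, hc, hz.1⟩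
  obtain ⟨t, ht⟩ := (hC.inter_right (isClosed_Ici (a := z))).exists_isLeast ⟨d, hd', hz.2⟩
  have hsz : s < z := lt_of_le_of_ne hs.1.2 fun h => hzC (h ▸ hs.1.1)
  have hzt : z < t := lt_of_le_of_ne ht.1.2 fun h => hzC (h ▸ ht.1.1)
  refine ⟨s, hs.1.1, t, ht.1.1, hyc.trans_le (hs.2 ⟨hc, hz.1⟩), hsz.trans hzt,
    (ht.2 ⟨hd', hz.2⟩).trans_lt hdu, fun x hx hxC => ?_⟩
  rcases le_total x z with h | h
  · exact hx.1.not_ge (hs.2 ⟨hxC, h⟩)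
  · exact hx.2.not_ge (ht.2 ⟨hxC, h⟩)

theorem CollapsesOnto.connectedComponentIn_preimage {f : ℝ → ℝ} {Q C : Set ℝ}
    (hf : CollapsesOnto f Q) (hd : IsTotallyDisconnected C) {x : ℝ} (hx : f x ∈ C) :
    connectedComponentIn (f ⁻¹' C) x = f ⁻¹' {f x} := by
  refine Subset.antisymm (fun y hy => ?_) ?_
  · refine hd (f '' connectedComponentIn (f ⁻¹' C) x) ?_
      (isPreconnected_connectedComponentIn.image _ hf.continuous.continuousOn)
      (mem_image_of_mem f hy) (mem_image_of_mem f (mem_connectedComponentIn hx))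
    exact image_subset_iff.2 (connectedComponentIn_subset _ _)
  · exact (ordConnected_singleton.preimage_mono hf.monotone).isPreconnected
      |>.subset_connectedComponentIn rfl (preimage_mono (singleton_subset_iff.2 hx))

theorem CollapsesOnto.isCompact_preimage {f : ℝ → ℝ} {Q C : Set ℝ} (hf : CollapsesOnto f Q)
    (hC : IsCompact C) : IsCompact (f ⁻¹' C) := by
  obtain ⟨m, hm⟩ := hC.bddBelow
  obtain ⟨M, hM⟩ := hC.bddAbove
  obtain ⟨y, hy⟩ := hf.surjective (m - 1)
  obtain ⟨z, hz⟩ := hf.surjective (M + 1)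
  refine (isCompact_Icc (a := y) (b := z)).of_isClosed_subset
    (hC.isClosed.preimage hf.continuous) fun x hx => ⟨?_, ?_⟩
  · exact (hf.monotone.reflect_lt (by linarith [hm hx])).le
  · exact (hf.monotone.reflect_lt (by linarith [hM hx])).le

theorem CollapsesOnto.isLCantorval_preimage {f : ℝ → ℝ} {C B : Set ℝ}
    (hf : CollapsesOnto f ({x ∈ C | ¬ IsLeftLimit C x} ∪ B))
    (hC : IsCompact C) (hne : C.Nonempty) (hd : IsTotallyDisconnected C)
    (hperf : ∀ x ∈ C, IsLeftLimit C x ∨ IsRightLimit C x)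
    (hB : ∀ x ∈ B, IsRightLimit C x) : IsLCantorval (f ⁻¹' C) := by
  have hmono := hf.monotone
  refine ⟨hne.preimage hf.surjective, hf.isCompact_preimage hC, fun a b hab hgap => ?_⟩
  obtain ⟨⟨x, hx, hxeq⟩, -⟩ := hgap
  have hxab : x ∈ Ioo a b := hxeq ▸ mem_connectedComponentIn hx
  have hsub : Ioo a b ⊆ (f ⁻¹' C)ᶜ := hxeq ▸ connectedComponentIn_subset _ _
  have ha : f a ∈ C := by
    by_contra h
    have : Ico a b ⊆ Ioo a b := by
      rw [hxeq]
      refine isPreconnected_Ico.subset_connectedComponentIn ⟨hxab.1.le, hxab.2⟩ fun z hz => ?_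
      rcases hz.1.eq_or_lt with rfl | h'
      exacts [h, hsub ⟨h', hz.2⟩]
    exact lt_irrefl a (this (left_mem_Ico.2 hab)).1
  have hb : f b ∈ C := by
    by_contra h
    have : Ioc a b ⊆ Ioo a b := by
      rw [hxeq]
      refine isPreconnected_Ioc.subset_connectedComponentIn ⟨hxab.1, hxab.2.le⟩ fun z hz => ?_
      rcases hz.2.eq_or_lt with rfl | h'
      exacts [h, hsub ⟨hz.1, h'⟩]
    exact lt_irrefl b (this (right_mem_Ioc.2 hab)).2
  have hlt : f a < f b := by
    refine (hmono hab.le).lt_of_ne fun h => hsub hxab ?_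
    have : f x = f a := le_antisymm (h ▸ hmono hxab.2.le) (hmono hxab.1.le)
    rw [mem_preimage, this]; exact ha
  have hdisj : C ∩ Ioo (f a) (f b) = ∅ := by
    refine eq_empty_of_forall_notMem fun z hz => ?_
    obtain ⟨y, rfl⟩ := hf.surjective z
    exact hsub ⟨hmono.reflect_lt hz.2.1, hmono.reflect_lt hz.2.2⟩ hz.1
  have hu : IsLeftLimit C (f a) := (hperf _ ha).resolve_right fun h => by
    simpa [hdisj] using h _ hlt
  have huQ : f a ∉ {x ∈ C | ¬ IsLeftLimit C x} ∪ B := by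
    rintro (h | h)
    · exact h.2 hu
    · simpa [hdisj] using hB _ h _ hlt
  have hvQ : f b ∈ {x ∈ C | ¬ IsLeftLimit C x} ∪ B :=
    .inl ⟨hb, fun h => by simpa [hdisj] using h _ hlt⟩
  refine ⟨⟨f ⁻¹' {f b}, ⟨⟨b, hb, (hf.connectedComponentIn_preimage hd hb).symm⟩, ?_⟩, rfl,
    fun y hy => ?_⟩, fun ε hε => ?_⟩
  · obtain ⟨y, z, hyz, hy, hz⟩ := hf.nontrivial_fiber _ hvQ
    exact ⟨y, hy, z, hz, hyz.ne⟩
  · have hy : f y = f b := hy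
    by_contra! h
    refine hsub ⟨hmono.reflect_lt (hy ▸ hlt), h⟩ ?_
    rw [mem_preimage, hy]; exact hb
  have hlt' : f (a - ε) < f a := by
    refine (hmono (by linarith)).lt_of_ne fun h => ?_
    have := hf.eq_of_notMem a (a - ε) h.symm huQ
    linarith
  have mem_of {y : ℝ} (h1 : f (a - ε) < f y) (h2 : f y < f a) : y ∈ Ioo (a - ε) a :=
    ⟨hmono.reflect_lt h1, hmono.reflect_lt h2⟩
  -- right endpoints of gaps of `C` accumulating at `f a` from the left
  set T : Set ℝ := {t ∈ C | t < f a ∧ ∃ s ∈ C, f (a - ε) < s ∧ s < t ∧ Ioo s t ⊆ Cᶜ} with hT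
  have hTinf : T.Infinite := by
    have hex {y : ℝ} (hy : f (a - ε) ≤ y) (hya : y < f a) : ∃ t ∈ T, y < t := by
      obtain ⟨s, hs, t, ht, h1, h2, h3, h4⟩ := hu.exists_gap hC hd hya
      exact ⟨t, ⟨ht, h3, s, hs, hy.trans_lt h1, h2, h4⟩, h1.trans h2⟩
    intro hfin
    obtain ⟨t, ht, -⟩ := hex le_rfl hlt'
    obtain ⟨m, ⟨-, hma, s, -, h1, h2, -⟩, hmax⟩ := hfin.isCompact.exists_isGreatest ⟨t, ht⟩
    obtain ⟨t, ht, hmt⟩ := hex (h1.trans h2).le hma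
    exact hmt.not_ge (hmax ht)
  constructor
  · refine (hTinf.image (f := fun t => f ⁻¹' {t}) ?_).mono ?_
    · intro s _ t _ hst
      obtain ⟨y, rfl⟩ := hf.surjective s
      exact (Set.ext_iff.1 hst y).1 rfl
    · rintro _ ⟨t, ⟨ht, hta, s, hs, h1, h2, h3⟩, rfl⟩
      have htQ : t ∈ {x ∈ C | ¬ IsLeftLimit C x} ∪ B := .inl ⟨ht, fun h => by
        obtain ⟨r, hr, hr'⟩ := h s h2
        exact h3 hr' hr⟩
      obtain ⟨y, z, hyz, rfl, hz⟩ := hf.nontrivial_fiber _ htQ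
      exact ⟨⟨⟨y, ht, (hf.connectedComponentIn_preimage hd ht).symm⟩, y, rfl, z, hz, hyz.ne⟩,
        y, rfl, mem_of (h1.trans h2) hta⟩
  · have hmid (t : ℝ) : ∃ y, t ∈ T → f y ∉ C ∧ f (a - ε) < f y ∧ f y < t ∧
        (∃ s ∈ C, s < f y) ∧ ∀ r ∈ T, r < t → r ≤ f y := by
      by_cases ht : t ∈ T
      · obtain ⟨htC, hta, s, hs, h1, h2, h3⟩ := ht
        obtain ⟨w, hw⟩ := exists_between h2
        obtain ⟨y, rfl⟩ := hf.surjective w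
        refine ⟨y, fun _ => ⟨h3 hw, h1.trans hw.1, hw.2, ⟨s, hs, hw.1⟩, fun r hr hrt => ?_⟩⟩
        by_contra! h
        exact h3 ⟨hw.1.trans h, hrt⟩ hr.1
      · exact ⟨0, fun h => absurd h ht⟩
    choose y hy using hmid
    have key {r t : ℝ} (hr : r ∈ T) (ht : t ∈ T) (hrt : r < t) :
        connectedComponentIn (f ⁻¹' C)ᶜ (y r) ≠ connectedComponentIn (f ⁻¹' C)ᶜ (y t) := by
      intro h
      obtain ⟨hr1, hr2, hr3, -⟩ := hy r hr
      obtain ⟨ht1, ht2, ht3, -, ht4⟩ := hy t ht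
      have hr' : y r ∈ connectedComponentIn (f ⁻¹' C)ᶜ (y t) :=
        h ▸ mem_connectedComponentIn hr1
      obtain ⟨z, rfl⟩ := hf.surjective r
      refine connectedComponentIn_subset _ _
        (isPreconnected_connectedComponentIn.ordConnected.out hr' (mem_connectedComponentIn ht1)
          (?_ : z ∈ Icc _ _)) hr.1
      have := (ht4 _ hr hrt).lt_of_ne fun h => ht1 (h ▸ hr.1)
      exact ⟨(hmono.reflect_lt hr3).le, (hmono.reflect_lt this).le⟩
    refine (hTinf.image (f := fun t => connectedComponentIn (f ⁻¹' C)ᶜ (y t)) ?_).mono ?_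
    · intro r hr t ht hrt
      by_contra hne
      rcases lt_or_gt_of_ne hne with h | h
      exacts [key hr ht h hrt, key ht hr h hrt.symm]
    · rintro _ ⟨t, ht, rfl⟩
      obtain ⟨h1, h2, h3, ⟨s, hs, hsy⟩, -⟩ := hy t ht
      refine ⟨⟨⟨y t, h1, rfl⟩, ?_⟩, y t, mem_connectedComponentIn h1, mem_of h2 (h3.trans ht.2.1)⟩
      obtain ⟨p, rfl⟩ := hf.surjective s
      obtain ⟨q, rfl⟩ := hf.surjective t
      refine (Metric.isBounded_Icc p q).subset fun z hz => ?_
      have hoc := (isPreconnected_connectedComponentIn (F := (f ⁻¹' C)ᶜ) (x := y (f q))).ordConnected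
      constructor
      · by_contra! h
        exact connectedComponentIn_subset _ _ (hoc.out hz (mem_connectedComponentIn h1)
          ⟨h.le, (hmono.reflect_lt hsy).le⟩) hs
      · by_contra! h
        exact connectedComponentIn_subset _ _ (hoc.out (mem_connectedComponentIn h1) hz
          ⟨(hmono.reflect_lt h3).le, h.le⟩) ht.1

open scoped Pointwise in
theorem volume_cantorSet : MeasureTheory.volume cantorSet = 0 := by
  have hfin : MeasureTheory.volume cantorSet ≠ ⊤ := isCompact_cantorSet.measure_ne_top
  have h1 : (· / 3) '' cantorSet = (3⁻¹ : ℝ) • cantorSet := by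
    ext; simp [mem_smul_set, div_eq_inv_mul]
  have h2 : (fun x => (2 + x) / 3) '' cantorSet = (fun x => 2 / 3 + x) '' ((3⁻¹ : ℝ) • cantorSet) := by
    rw [← h1, image_image]; exact image_congr fun x _ => by ring
  have h := MeasureTheory.measure_union_le (μ := MeasureTheory.volume)
    ((· / 3) '' cantorSet) ((fun x => (2 + x) / 3) '' cantorSet)
  rw [← cantorSet_eq_union_halves, h2, h1, image_add_left, MeasureTheory.measure_preimage_add,
    MeasureTheory.Measure.addHaar_smul] at h
  refine ((ENNReal.toReal_eq_zero_iff _).1 ?_).resolve_right hfin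
  have h' := ENNReal.toReal_mono (by finiteness) h
  rw [ENNReal.toReal_add (by finiteness) (by finiteness), ENNReal.toReal_mul,
    ENNReal.toReal_ofReal (abs_nonneg _), Module.finrank_self, pow_one,
    abs_of_pos (by norm_num : (0 : ℝ) < 3⁻¹)] at h'
  linarith [ENNReal.toReal_nonneg (a := MeasureTheory.volume cantorSet)]

theorem exists_mem_cantorSet_ne {x : ℝ} (hx : x ∈ cantorSet) {ε : ℝ} (hε : 0 < ε) :
    ∃ y ∈ cantorSet, y ≠ x ∧ |y - x| < ε := by
  obtain ⟨n, hn⟩ := exists_pow_lt_of_lt_one hε (by norm_num : (3⁻¹ : ℝ) < 1)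
  suffices H : ∃ y ∈ cantorSet, y ≠ x ∧ |y - x| ≤ 3⁻¹ ^ n by
    obtain ⟨y, h1, h2, h3⟩ := H
    exact ⟨y, h1, h2, h3.trans_lt hn⟩
  clear hn
  induction n generalizing x with
  | zero =>
    have hx' := cantorSet_subset_unitInterval hx
    by_cases h : x = 0
    · exact ⟨1 / 4, quarter_mem_cantorSet, by rw [h]; norm_num, by rw [h]; norm_num [abs_le]⟩
    · exact ⟨0, zero_mem_cantorSet, Ne.symm h, by simpa [abs_le] using ⟨by linarith [hx'.1], hx'.2⟩⟩
  | succ n ih =>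
    have step {z : ℝ} (hz : z ∈ cantorSet) (c : ℝ)
        (hc : ∀ y ∈ cantorSet, (c + y) / 3 ∈ cantorSet) :
        ∃ y ∈ cantorSet, y ≠ (c + z) / 3 ∧ |y - (c + z) / 3| ≤ 3⁻¹ ^ (n + 1) := by
      obtain ⟨y, hy, hne, hle⟩ := ih hz
      refine ⟨(c + y) / 3, hc y hy, fun h => hne (by linarith), ?_⟩
      rw [show (c + y) / 3 - (c + z) / 3 = 3⁻¹ * (y - z) by ring, abs_mul, pow_succ',
        abs_of_pos (by norm_num : (0 : ℝ) < 3⁻¹)]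
      gcongr
    rw [cantorSet_eq_union_halves] at hx
    rcases hx with ⟨z, hz, rfl⟩ | ⟨z, hz, rfl⟩
    · simpa using step hz 0 fun y hy => by
        rw [cantorSet_eq_union_halves]; exact .inl ⟨y, hy, by simp⟩
    · exact step hz 2 fun y hy => by
        rw [cantorSet_eq_union_halves]; exact .inr ⟨y, hy, rfl⟩

/-- Every countable compact set of reals lies in a Cantor set none of whose gaps it touches. -/
theorem exists_cantor_superset {K : Set ℝ} (hK : IsCompact K) (hcount : K.Countable) :
    ∃ C : Set ℝ, IsCompact C ∧ K ⊆ C ∧ IsTotallyDisconnected C ∧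
      (∀ x ∈ C, IsLeftLimit C x ∨ IsRightLimit C x) ∧
      ∀ x ∈ K, IsLeftLimit C x ∧ IsRightLimit C x := by
  set C : Set ℝ := (fun p : ℝ × ℝ => p.1 + p.2) '' (K ×ˢ cantorSet) ∪
    (fun p : ℝ × ℝ => p.1 - p.2) '' (K ×ˢ cantorSet) with hC
  have hadd {k d : ℝ} (hk : k ∈ K) (hd : d ∈ cantorSet) : k + d ∈ C := .inl ⟨(k, d), ⟨hk, hd⟩, rfl⟩
  have hsub {k d : ℝ} (hk : k ∈ K) (hd : d ∈ cantorSet) : k - d ∈ C := .inr ⟨(k, d), ⟨hk, hd⟩, rfl⟩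
  have hnull : MeasureTheory.volume C = 0 := by
    have : C ⊆ ⋃ k ∈ K, ((fun x => -k + x) ⁻¹' cantorSet ∪ (fun x => k - x) ⁻¹' cantorSet) := by
      rintro _ (⟨⟨k, d⟩, ⟨hk, hd⟩, rfl⟩ | ⟨⟨k, d⟩, ⟨hk, hd⟩, rfl⟩)
      · exact mem_biUnion hk (.inl (by simpa using hd))
      · exact mem_biUnion hk (.inr (by simpa using hd))
    refine MeasureTheory.measure_mono_null this
      ((MeasureTheory.measure_biUnion_null_iff hcount).2 fun k _ => ?_)
    rw [MeasureTheory.measure_union_null_iff, MeasureTheory.measure_preimage_add]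
    exact ⟨volume_cantorSet, (MeasureTheory.Measure.measurePreserving_sub_left _ k).quasiMeasurePreserving.preimage_null volume_cantorSet⟩
  have hperf : ∀ x ∈ C, ∀ ε > 0, ∃ y ∈ C, y ≠ x ∧ |y - x| < ε := by
    rintro _ (⟨⟨k, d⟩, ⟨hk, hd⟩, rfl⟩ | ⟨⟨k, d⟩, ⟨hk, hd⟩, rfl⟩) ε hε
    · obtain ⟨e, he, hne, hlt⟩ := exists_mem_cantorSet_ne hd hε
      exact ⟨k + e, hadd hk he, by simpa using hne, by simpa using hlt⟩
    · obtain ⟨e, he, hne, hlt⟩ := exists_mem_cantorSet_ne hd hε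
      exact ⟨k - e, hsub hk he, by simpa using hne, by simpa [abs_sub_comm] using hlt⟩
  have hsmall {ε : ℝ} (hε : 0 < ε) : ∃ d ∈ cantorSet, 0 < d ∧ d < ε := by
    obtain ⟨d, hd, hne, hlt⟩ := exists_mem_cantorSet_ne zero_mem_cantorSet hε
    have := (cantorSet_subset_unitInterval hd).1
    exact ⟨d, hd, this.lt_of_ne' hne, (le_abs_self d).trans_lt (by simpa using hlt)⟩
  refine ⟨C, ?_, fun k hk => by simpa using hadd hk zero_mem_cantorSet, ?_, fun x hx => ?_,
    fun k hk => ⟨fun y hy => ?_, fun y hy => ?_⟩⟩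
  · exact ((hK.prod isCompact_cantorSet).image (by fun_prop)).union
      ((hK.prod isCompact_cantorSet).image (by fun_prop))
  · intro s hs hconn x hx y hy
    by_contra hne
    wlog h : x < y generalizing x y
    · exact this hy hx (Ne.symm hne) (lt_of_le_of_ne (not_lt.1 h) (Ne.symm hne))
    have := MeasureTheory.measure_mono_null ((hconn.ordConnected.out hx hy).trans hs) hnull
    rw [Real.volume_Icc, ENNReal.ofReal_eq_zero] at this
    linarith
  · by_contra! h
    simp only [IsLeftLimit, IsRightLimit, not_forall, not_nonempty_iff_eq_empty] at h
    obtain ⟨⟨l, hl, hl'⟩, r, hr, hr'⟩ := h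
    obtain ⟨y, hy, hne, hlt⟩ := hperf x hx (min (x - l) (r - x)) (by simp [hl, hr.lt])
    rw [abs_lt, lt_min_iff] at hlt
    have h1 := min_le_left (x - l) (r - x)
    rcases lt_or_gt_of_ne hne with h | h
    · exact eq_empty_iff_forall_notMem.1 hl' y ⟨hy, by linarith [hlt.1], h⟩
    · exact eq_empty_iff_forall_notMem.1 hr' y ⟨hy, h, by linarith [hlt.2.2]⟩
  · obtain ⟨d, hd, hpos, hlt⟩ := hsmall (sub_pos.2 hy)
    exact ⟨k - d, hsub hk hd, by linarith, by linarith⟩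
  · obtain ⟨d, hd, hpos, hlt⟩ := hsmall (sub_pos.2 hy)
    exact ⟨k + d, hadd hk hd, by linarith, by linarith⟩

/-- Characteristic functions of the sets `F` of naturals with `|F| + n ≤ min F`, a variant of the
Schreier family. -/
def schreier (n : ℕ) : Set (ℕ → Bool) :=
  {x | ∀ i, x i = true → ∀ s : Finset ℕ, (∀ j ∈ s, x j = true) → s.card + n ≤ i}

theorem isClosed_schreier (n : ℕ) : IsClosed (schreier n) := by
  simp only [schreier, ofPred_forall]
  refine isClosed_iInter fun i => ?_
  have hop (j : ℕ) : IsOpen {x : ℕ → Bool | x j = true} :=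
    (isOpen_discrete {true} : IsOpen ({true} : Set Bool)).preimage
      (continuous_apply j : Continuous fun x : ℕ → Bool => x j)
  refine isClosed_imp (hop i) ?_
  rw [ofPred_forall]
  refine isClosed_iInter fun s => isClosed_imp ?_ isClosed_const
  simp only [ofPred_forall]
  exact isOpen_biInter_finset fun j _ => hop j

theorem finite_setOf_eq_true_of_mem_schreier {n : ℕ} {x : ℕ → Bool} (hx : x ∈ schreier n) :
    {i | x i = true}.Finite := by
  by_contra h
  obtain ⟨i, hi⟩ := Set.Infinite.nonempty h
  obtain ⟨s, hs, hcard⟩ := Set.Infinite.exists_subset_card_eq h (i + 1)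
  have := hx i hi s fun j hj => hs hj
  omega

theorem countable_schreier (n : ℕ) : (schreier n).Countable := by
  refine (countable_range fun s : Finset ℕ => fun i => decide (i ∈ s)).mono fun x hx => ?_
  refine ⟨(finite_setOf_eq_true_of_mem_schreier hx).toFinset, ?_⟩
  ext i
  simp

theorem derivedSet_schreier (n : ℕ) : derivedSet (schreier n) = schreier (n + 1) := by
  ext x
  rw [mem_derivedSet]
  constructor
  · intro h i hi s hs
    have hx : x ∈ schreier n :=
      (isClosed_iff_derivedSet_subset _).1 (isClosed_schreier n) h
    by_contra! hlt
    have hmax (j : ℕ) (hj : x j = true) : j ∈ s := by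
      by_contra hjs
      have := hx i hi (insert j s) (by simpa [hj] using hs)
      rw [Finset.card_insert_of_notMem hjs] at this
      omega
    have hnear : ∀ᶠ y in 𝓝 x, ∀ j ∈ s, y j = x j :=
      (s.eventually_all).2 fun j _ =>
        (((continuous_apply j).tendsto x).eventually_mem
          ((isOpen_discrete {x j}).mem_nhds rfl)).mono fun _ h => h
    obtain ⟨y, ⟨hne, hy⟩, hys⟩ := ((accPt_iff_frequently.1 h).and_eventually hnear).exists
    obtain ⟨j, hj⟩ := Function.ne_iff.1 hne
    have hjs : j ∉ s := fun hjs => hj (hys j hjs)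
    have hyj : y j = true := by
      cases hxj : x j
      · simpa [hxj] using hj
      · exact absurd (hmax j hxj) hjs
    have := hy i ((hys i (hmax i hi)).trans hi) (insert j s) (by
      simpa [hyj] using fun k hk => (hys k hk).trans (hs k hk))
    rw [Finset.card_insert_of_notMem hjs] at this
    omega
  · intro hx
    have hlim : Tendsto (fun k => Function.update x k true) atTop (𝓝 x) := by
      refine tendsto_pi_nhds.2 fun j => tendsto_const_nhds.congr' ?_
      filter_upwards [eventually_gt_atTop j] with k hk
      simp [Function.update_of_ne hk.ne]
    obtain ⟨N, hN⟩ := (finite_setOf_eq_true_of_mem_schreier hx).bddAbove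
    refine accPt_iff_frequently.2 (hlim.frequently (Eventually.frequently ?_))
    filter_upwards [eventually_gt_atTop (N + n + 1)] with k hk
    have hxk : x k = false := by
      by_contra h
      have : k ≤ N := hN (by simpa using h)
      omega
    refine ⟨fun h => by simpa [hxk] using congrFun h k, fun i hi s hs => ?_⟩
    have hs' : ∀ j ∈ s.erase k, x j = true := fun j hj => by
      have := hs j (Finset.mem_of_mem_erase hj)
      rwa [Function.update_of_ne (Finset.ne_of_mem_erase hj)] at this
    have hcard := Finset.pred_card_le_card_erase (s := s) (a := k)
    by_cases hik : i = k
    · subst hik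
      rcases (s.erase i).eq_empty_or_nonempty with h | ⟨j, hj⟩
      · simp only [h, Finset.card_empty] at hcard
        omega
      · have := hx j (hs' j hj) _ hs'
        have : j ≤ N := hN (hs' j hj)
        omega
    · rw [Function.update_of_ne hik] at hi
      have := hx i hi _ hs'
      omega

theorem iterate_derivedSet_schreier (n : ℕ) : derivedSet^[n] (schreier 0) = schreier n := by
  induction n with
  | zero => rfl
  | succ n ih => rw [Function.iterate_succ_apply', ih, derivedSet_schreier]

theorem schreier_sdiff_nonempty (n : ℕ) : (schreier n \ schreier (n + 1)).Nonempty := by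
  refine ⟨fun i => decide (i = n + 1), fun i hi s hs => ?_, fun h => ?_⟩
  · have hi : i = n + 1 := by simpa using hi
    have : s ⊆ {n + 1} := fun j hj => by simpa using hs j hj
    have := Finset.card_le_card this
    rw [Finset.card_singleton] at this
    omega
  · have := h (n + 1) (by simp) {n + 1} (by simp)
    simp at this

theorem Topology.IsClosedEmbedding.derivedSet_image {X Y : Type*} [TopologicalSpace X]
    [TopologicalSpace Y] {e : X → Y} (he : IsClosedEmbedding e) (A : Set X) :
    derivedSet (e '' A) = e '' derivedSet A := by
  refine Subset.antisymm (fun y hy => ?_) (he.continuous.image_derivedSet he.injective)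
  obtain ⟨x, rfl⟩ : y ∈ range e :=
    closure_minimal (image_subset_range e A) he.isClosed_range (derivedSet_subset_closure _ hy)
  refine ⟨x, ?_, rfl⟩
  rw [mem_derivedSet, accPt_iff_nhds] at hy ⊢
  intro U hU
  obtain ⟨V, hV, hVU⟩ := (he.isInducing.nhds_eq_comap x ▸ mem_comap).1 hU
  obtain ⟨_, ⟨h1, a, ha, rfl⟩, hne⟩ := hy V hV
  exact ⟨a, ⟨hVU h1, ha⟩, fun h => hne (h ▸ rfl)⟩

theorem Topology.IsClosedEmbedding.iterate_derivedSet_image {X Y : Type*} [TopologicalSpace X]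
    [TopologicalSpace Y] {e : X → Y} (he : IsClosedEmbedding e) (A : Set X) (n : ℕ) :
    derivedSet^[n] (e '' A) = e '' (derivedSet^[n] A) := by
  induction n with
  | zero => rfl
  | succ n ih => rw [Function.iterate_succ_apply', ih, he.derivedSet_image,
      Function.iterate_succ_apply']

/-- The connected component of `p` has two points that are limits of points outside it. -/
def IsTwoSided {X : Type*} [TopologicalSpace X] (p : X) : Prop :=
  ∃ y ∈ connectedComponent p, ∃ z ∈ connectedComponent p, y ≠ z ∧
    y ∈ closure (connectedComponent p)ᶜ ∧ z ∈ closure (connectedComponent p)ᶜ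

theorem Homeomorph.apply_mem_connectedComponent_iff {X Y : Type*} [TopologicalSpace X]
    [TopologicalSpace Y] (φ : X ≃ₜ Y) {x y : X} :
    φ y ∈ connectedComponent (φ x) ↔ y ∈ connectedComponent x := by
  refine ⟨fun h => ?_, fun h => φ.continuous.mapsTo_connectedComponent x h⟩
  simpa using φ.symm.continuous.mapsTo_connectedComponent _ h

theorem IsTwoSided.map {X Y : Type*} [TopologicalSpace X] [TopologicalSpace Y] (φ : X ≃ₜ Y)
    {p : X} (hp : IsTwoSided p) : IsTwoSided (φ p) := by
  have hcl {y : X} (hy : y ∈ closure (connectedComponent p)ᶜ) :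
      φ y ∈ closure (connectedComponent (φ p))ᶜ :=
    map_mem_closure φ.continuous hy fun z hz => mt φ.apply_mem_connectedComponent_iff.1 hz
  obtain ⟨y, hy, z, hz, hne, hy', hz'⟩ := hp
  exact ⟨φ y, φ.apply_mem_connectedComponent_iff.2 hy, φ z,
    φ.apply_mem_connectedComponent_iff.2 hz, φ.injective.ne hne, hcl hy', hcl hz'⟩

theorem Homeomorph.isTwoSided_apply_iff {X Y : Type*} [TopologicalSpace X] [TopologicalSpace Y]
    (φ : X ≃ₜ Y) {p : X} : IsTwoSided (φ p) ↔ IsTwoSided p :=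
  ⟨fun h => by simpa using h.map φ.symm, fun h => h.map φ⟩

theorem CollapsesOnto.mem_connectedComponent_iff {f : ℝ → ℝ} {Q C : Set ℝ}
    (hf : CollapsesOnto f Q) (hd : IsTotallyDisconnected C) {x y : f ⁻¹' C} :
    y ∈ connectedComponent x ↔ f y = f x := by
  have h := hf.connectedComponentIn_preimage hd x.2
  rw [connectedComponentIn_eq_image x.2] at h
  rw [← Subtype.val_injective.mem_set_image, h]
  rfl

theorem CollapsesOnto.isTwoSided_iff {f : ℝ → ℝ} {C B : Set ℝ}
    (hf : CollapsesOnto f ({x ∈ C | ¬ IsLeftLimit C x} ∪ B)) (hd : IsTotallyDisconnected C)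
    (hB : ∀ x ∈ B, IsLeftLimit C x ∧ IsRightLimit C x) {p : f ⁻¹' C} :
    IsTwoSided p ↔ f p ∈ B := by
  have hmono := hf.monotone
  constructor
  · rintro ⟨y, hy, z, hz, hne, hy', hz'⟩
    wlog hyz : y < z generalizing y z
    · exact this z hz y hy hne.symm hz' hy' (lt_of_le_of_ne (not_lt.1 hyz) hne.symm)
    rw [hf.mem_connectedComponent_iff hd] at hy hz
    by_contra hpB
    have hpQ : f y ∈ {x ∈ C | ¬ IsLeftLimit C x} ∪ B := by
      by_contra h
      exact hne (Subtype.ext (hf.eq_of_notMem y z (hy.trans hz.symm) h))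
    have hleft := (hpQ.resolve_right (hy ▸ hpB)).2
    simp only [IsLeftLimit, not_forall] at hleft
    obtain ⟨l, hl, hempty⟩ := hleft
    have hopen : IsOpen {x : f ⁻¹' C | l < f x ∧ x < z} :=
      (isOpen_lt continuous_const (hf.continuous.comp continuous_subtype_val)).inter isOpen_Iio
    obtain ⟨x, ⟨hlx, hxz⟩, hx⟩ := mem_closure_iff.1 hy' _ hopen ⟨hl, hyz⟩
    rw [mem_compl_iff, hf.mem_connectedComponent_iff hd] at hx
    refine hempty ⟨f x, x.2, hlx, ?_⟩
    rw [hy]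
    exact lt_of_le_of_ne (hz ▸ hmono hxz.le) hx
  · intro hp
    have hcpt := hf.isCompact_preimage (isCompact_singleton (x := f p))
    obtain ⟨a, ha, hamin⟩ := hcpt.exists_isLeast ⟨p, rfl⟩
    obtain ⟨b, hb, hbmax⟩ := hcpt.exists_isGreatest ⟨p, rfl⟩
    have ha : f a = f p := ha
    have hb : f b = f p := hb
    have haC : f a ∈ C := ha ▸ p.2
    have hbC : f b ∈ C := hb ▸ p.2
    have hab : a ≠ b := by
      obtain ⟨y, z, hyz, hy, hz⟩ := hf.nontrivial_fiber _ (.inr hp)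
      exact ((hamin hy).trans_lt (hyz.trans_le (hbmax hz))).ne
    refine ⟨⟨a, haC⟩, (hf.mem_connectedComponent_iff hd).2 ha, ⟨b, hbC⟩,
      (hf.mem_connectedComponent_iff hd).2 hb, by simpa using hab, ?_, ?_⟩
    · rw [closure_subtype, Real.mem_closure_iff]
      intro ε hε
      have hlt : f (a - ε) < f p := ha ▸ (hmono (by linarith)).lt_of_ne fun h => by
        linarith [hamin (show a - ε ∈ f ⁻¹' {f p} from h.trans ha)]
      obtain ⟨_, hc, hc1, hc2⟩ := (hB _ hp).1 _ hlt
      obtain ⟨w, rfl⟩ := hf.surjective ‹_›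
      refine ⟨w, ⟨⟨w, hc⟩, fun h => hc2.ne ((hf.mem_connectedComponent_iff hd).1 h), rfl⟩, ?_⟩
      have h1 := hmono.reflect_lt hc1
      have h2 := hmono.reflect_lt (ha ▸ hc2 : f w < f a)
      rw [abs_lt]; constructor <;> simp only <;> linarith
    · rw [closure_subtype, Real.mem_closure_iff]
      intro ε hε
      have hlt : f p < f (b + ε) := hb ▸ (hmono (by linarith)).lt_of_ne fun h => by
        linarith [hbmax (show b + ε ∈ f ⁻¹' {f p} from h.symm.trans hb)]
      obtain ⟨_, hc, hc1, hc2⟩ := (hB _ hp).2 _ hlt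
      obtain ⟨w, rfl⟩ := hf.surjective ‹_›
      refine ⟨w, ⟨⟨w, hc⟩, fun h => hc1.ne' ((hf.mem_connectedComponent_iff hd).1 h), rfl⟩, ?_⟩
      have h1 := hmono.reflect_lt hc2
      have h2 := hmono.reflect_lt (hb ▸ hc1 : f b < f w)
      rw [abs_lt]; constructor <;> simp only <;> linarith

theorem Topology.IsQuotientMap.exists_homeomorph {X Y A B : Type*} [TopologicalSpace X]
    [TopologicalSpace Y] [TopologicalSpace A] [TopologicalSpace B] {F : X → A} {G : Y → B}
    (hF : IsQuotientMap F) (hG : IsQuotientMap G) (φ : X ≃ₜ Y)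
    (hφ : ∀ x y, F x = F y ↔ G (φ x) = G (φ y)) : ∃ h : A ≃ₜ B, ∀ x, h (F x) = G (φ x) := by
  choose s hs using hF.surjective
  choose t ht using hG.surjective
  have hst (x : X) : G (φ (s (F x))) = G (φ x) := (hφ _ _).1 (hs _)
  have hts (y : Y) : F (φ.symm (t (G y))) = F (φ.symm y) := by
    rw [hφ]; simpa using ht _
  refine ⟨⟨⟨fun a => G (φ (s a)), fun b => F (φ.symm (t b)), fun a => ?_, fun b => ?_⟩, ?_, ?_⟩, hst⟩
  · exact (hts _).trans (by rw [φ.symm_apply_apply, hs])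
  · exact (hst _).trans (by rw [φ.apply_symm_apply, ht])
  · exact hF.continuous_iff.2 ((hG.continuous.comp φ.continuous).congr fun x => (hst x).symm)
  · exact hG.continuous_iff.2 ((hF.continuous.comp φ.symm.continuous).congr fun y => (hts y).symm)

theorem CollapsesOnto.isQuotientMap_restrictPreimage {f : ℝ → ℝ} {Q C : Set ℝ}
    (hf : CollapsesOnto f Q) (hC : IsCompact C) : IsQuotientMap (C.restrictPreimage f) := by
  have := isCompact_iff_compactSpace.1 (hf.isCompact_preimage hC)
  exact (hf.continuous.restrictPreimage.isClosedMap).isQuotientMap hf.continuous.restrictPreimage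
    (restrictPreimage_surjective C hf.surjective)

/-- A homeomorphism between two blow-ups of `C` induces a self-homeomorphism of `C` matching the
two-sided blown-up points. -/
theorem CollapsesOnto.exists_homeomorph {f g : ℝ → ℝ} {C A B : Set ℝ}
    (hf : CollapsesOnto f ({x ∈ C | ¬ IsLeftLimit C x} ∪ A))
    (hg : CollapsesOnto g ({x ∈ C | ¬ IsLeftLimit C x} ∪ B))
    (hC : IsCompact C) (hd : IsTotallyDisconnected C)
    (hA : ∀ x ∈ A, IsLeftLimit C x ∧ IsRightLimit C x)
    (hB : ∀ x ∈ B, IsLeftLimit C x ∧ IsRightLimit C x) (φ : f ⁻¹' C ≃ₜ g ⁻¹' C) :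
    ∃ h : C ≃ₜ C, ∀ c : C, (h c : ℝ) ∈ B ↔ (c : ℝ) ∈ A := by
  obtain ⟨h, hh⟩ := (hf.isQuotientMap_restrictPreimage hC).exists_homeomorph
    (hg.isQuotientMap_restrictPreimage hC) φ fun x y => by
      rw [Subtype.ext_iff, Subtype.ext_iff]
      exact (hf.mem_connectedComponent_iff hd).symm.trans
        (φ.apply_mem_connectedComponent_iff.symm.trans (hg.mem_connectedComponent_iff hd))
  refine ⟨h, fun c => ?_⟩
  obtain ⟨x, rfl⟩ := (hf.isQuotientMap_restrictPreimage hC).surjective c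
  rw [hh]
  exact (hg.isTwoSided_iff hd hB).symm.trans
    (φ.isTwoSided_apply_iff.trans (hf.isTwoSided_iff hd hA))

section CantorBendixson

variable {X : Type*} [TopologicalSpace X]

theorem IsClosed.iterate_derivedSet [T1Space X] {K : Set X} (hK : IsClosed K) (n : ℕ) :
    IsClosed (derivedSet^[n] K) := by
  cases n with
  | zero => exact hK
  | succ n => rw [Function.iterate_succ_apply']; exact isClosed_derivedSet _

theorem IsClosed.antitone_iterate_derivedSet [T1Space X] {K : Set X} (hK : IsClosed K) :
    Antitone fun n => derivedSet^[n] K :=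
  antitone_nat_of_succ_le fun n => by
    rw [Function.iterate_succ_apply']
    exact (isClosed_iff_derivedSet_subset _).1 (hK.iterate_derivedSet n)

/-- The points of `K` of Cantor–Bendixson rank exactly `n`. -/
def pointsOfRank (K : Set X) (n : ℕ) : Set X := derivedSet^[n] K \ derivedSet^[n + 1] K

/-- `K` without the points whose rank is `2 * n + 1` for some `n ∈ S`. -/
def removeOddRanks (K : Set X) (S : Set ℕ) : Set X := K \ ⋃ n ∈ S, pointsOfRank K (2 * n + 1)

theorem IsClosed.eq_of_mem_pointsOfRank [T1Space X] {K : Set X} (hK : IsClosed K) {x : X}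
    {m n : ℕ} (hm : x ∈ pointsOfRank K m) (hn : x ∈ pointsOfRank K n) : m = n := by
  by_contra hne
  rcases lt_or_gt_of_ne hne with h | h
  · exact hm.2 (hK.antitone_iterate_derivedSet h hn.1)
  · exact hn.2 (hK.antitone_iterate_derivedSet h hm.1)

theorem IsClosed.closure_removeOddRanks [T1Space X] {K : Set X} (hK : IsClosed K) (S : Set ℕ) :
    closure (removeOddRanks K S) = K := by
  refine (closure_minimal sdiff_subset hK).antisymm fun x hx => ?_
  by_cases hxS : x ∈ removeOddRanks K S
  · exact subset_closure hxS
  obtain ⟨n, -, hn⟩ : ∃ n ∈ S, x ∈ pointsOfRank K (2 * n + 1) := by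
    simpa [removeOddRanks, hx] using hxS
  have hsub : pointsOfRank K (2 * n) ⊆ removeOddRanks K S := fun y hy => by
    refine ⟨hK.antitone_iterate_derivedSet (Nat.zero_le _) hy.1, fun h => ?_⟩
    simp only [mem_iUnion] at h
    obtain ⟨m, -, hm⟩ := h
    have := hK.eq_of_mem_pointsOfRank hy hm
    omega
  refine closure_mono hsub (derivedSet_subset_closure _ ?_)
  have hunion : derivedSet^[2 * n] K ⊆ pointsOfRank K (2 * n) ∪ derivedSet^[2 * n + 1] K :=
    fun y hy => by by_cases h : y ∈ derivedSet^[2 * n + 1] K <;> [exact .inr h; exact .inl ⟨hy, h⟩]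
  have h1 := hn.1
  have h2 := hn.2
  rw [Function.iterate_succ_apply'] at h1 h2
  have := derivedSet_mono _ _ hunion h1
  rw [derivedSet_union] at this
  exact this.resolve_right h2

theorem Homeomorph.subset_of_mem_removeOddRanks_iff [T1Space X] {K : Set X} (hK : IsClosed K)
    (hrank : ∀ n, (pointsOfRank K n).Nonempty) {S T : Set ℕ} (h : X ≃ₜ X)
    (hST : ∀ x, h x ∈ removeOddRanks K T ↔ x ∈ removeOddRanks K S) : S ⊆ T := by
  have himage : h '' removeOddRanks K S = removeOddRanks K T := by
    ext y
    obtain ⟨x, rfl⟩ := h.surjective y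
    rw [h.injective.mem_set_image, hST]
  have hKK : h '' K = K := by
    rw [← hK.closure_removeOddRanks S, h.image_closure, himage, hK.closure_removeOddRanks,
      hK.closure_removeOddRanks]
  have hiter (n : ℕ) (x : X) : h x ∈ derivedSet^[n] K ↔ x ∈ derivedSet^[n] K := by
    rw [← h.injective.mem_set_image (a := x),
      ← h.isClosedEmbedding.iterate_derivedSet_image, hKK]
  intro n hn
  obtain ⟨x, hx⟩ := hrank (2 * n + 1)
  have hhx : h x ∈ pointsOfRank K (2 * n + 1) :=
    ⟨(hiter _ _).2 hx.1, fun h' => hx.2 ((hiter _ _).1 h')⟩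
  have hxS : h x ∉ removeOddRanks K T := fun h' =>
    ((hST x).1 h').2 (mem_biUnion hn hx)
  have hxK : h x ∈ K := hK.antitone_iterate_derivedSet (Nat.zero_le _) hhx.1
  obtain ⟨m, hm, hxm⟩ : ∃ m ∈ T, h x ∈ pointsOfRank K (2 * m + 1) := by
    simpa [removeOddRanks, hxK] using hxS
  have := hK.eq_of_mem_pointsOfRank hhx hxm
  obtain rfl : n = m := by omega
  exact hm

theorem Topology.IsClosedEmbedding.image_pointsOfRank {Y : Type*} [TopologicalSpace Y] {e : X → Y}
    (he : IsClosedEmbedding e) (K : Set X) (n : ℕ) :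
    pointsOfRank (e '' K) n = e '' pointsOfRank K n := by
  rw [pointsOfRank, he.iterate_derivedSet_image, he.iterate_derivedSet_image,
    ← image_sdiff he.injective, pointsOfRank]

theorem Topology.IsClosedEmbedding.image_removeOddRanks {Y : Type*} [TopologicalSpace Y]
    {e : X → Y} (he : IsClosedEmbedding e) (K : Set X) (S : Set ℕ) :
    removeOddRanks (e '' K) S = e '' removeOddRanks K S := by
  simp only [removeOddRanks, he.image_pointsOfRank, image_sdiff he.injective, image_iUnion]

end CantorBendixson

/-- There is a countable compact set of reals of infinite Cantor–Bendixson rank. -/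
theorem exists_countable_compact_pointsOfRank_nonempty : ∃ K : Set ℝ, IsCompact K ∧ K.Countable ∧
    ∀ n, (pointsOfRank K n).Nonempty := by
  obtain ⟨e, he⟩ : ∃ e : (ℕ → Bool) → ℝ, IsClosedEmbedding e :=
    ⟨_, isClosed_cantorSet.isClosedEmbedding_subtypeVal.comp
      cantorSetHomeomorphNatToBool.symm.isClosedEmbedding⟩
  refine ⟨e '' schreier 0, (isClosed_schreier 0).isCompact.image he.continuous,
    (countable_schreier 0).image e, fun n => ?_⟩
  rw [he.image_pointsOfRank, pointsOfRank, iterate_derivedSet_schreier,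
    iterate_derivedSet_schreier]
  exact (schreier_sdiff_nonempty n).image e

/-- There are continuum many pairwise non-homeomorphic L-Cantorvals. -/
theorem continuum_many_LCantorvals :
    ∃ (I : Type) (Xf : I → Set ℝ), Cardinal.mk I = Cardinal.continuum ∧
      (∀ i : I, IsLCantorval (Xf i)) ∧
      ∀ i j : I, i ≠ j → IsEmpty (↥(Xf i) ≃ₜ ↥(Xf j)) := by
  obtain ⟨K, hK, hKcount, hrank⟩ := exists_countable_compact_pointsOfRank_nonempty
  obtain ⟨C, hC, hKC, hd, hperf, hKlim⟩ := exists_cantor_superset hK hKcount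
  have hcoe := hC.isClosed.isClosedEmbedding_subtypeVal
  set L : Set C := (↑) ⁻¹' K with hL
  have hLK : (↑) '' L = K := by simpa [hL] using hKC
  have hLrank (n : ℕ) : (pointsOfRank L n).Nonempty := by
    rw [← image_nonempty (f := ((↑) : C → ℝ)), ← hcoe.image_pointsOfRank, hLK]
    exact hrank n
  have hLclosed : IsClosed L := hK.isClosed.preimage continuous_subtype_val
  have hmem (S : Set ℕ) (c : C) : (c : ℝ) ∈ removeOddRanks K S ↔ c ∈ removeOddRanks L S := by
    rw [← hLK, hcoe.image_removeOddRanks, Subtype.val_injective.mem_set_image]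
  have hlim (S : Set ℕ) : ∀ x ∈ removeOddRanks K S, IsLeftLimit C x ∧ IsRightLimit C x :=
    fun x hx => hKlim x hx.1
  choose f hf using fun S : Set ℕ => exists_collapsesOnto
    ((countable_setOf_not_isLeftLimit C).union (hKcount.mono (sdiff_subset : removeOddRanks K S ⊆ K)))
  have hne : C.Nonempty := (hrank 0).mono (fun x hx => hKC hx.1)
  refine ⟨Set ℕ, fun S => f S ⁻¹' C, by simp, fun S => ?_, fun S T hST => ⟨fun φ => hST ?_⟩⟩
  · exact (hf S).isLCantorval_preimage hC hne hd hperf fun x hx => (hlim S x hx).2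
  · have key {S T : Set ℕ} (φ : f S ⁻¹' C ≃ₜ f T ⁻¹' C) : S ⊆ T := by
      obtain ⟨h, hh⟩ := (hf S).exists_homeomorph (hf T) hC hd (hlim S) (hlim T) φ
      exact h.subset_of_mem_removeOddRanks_iff hLclosed hLrank fun c =>
        (hmem T _).symm.trans ((hh c).trans (hmem S c))
    exact (key φ).antisymm (key φ.symm)
end
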